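/- arXiv:1207.2117 — 7 statements merged into one kernel-verified Lean document; each statement's English description precedes it below -/
import Mathlib

section
/- Let t ≥ 1 be an integer and let G be a finite simple graph that does not contain an immersion of the complete graph K_t. Then there exists a laminar family F of subsets of V(G) such that for every X ∈ F the edge-cut δ(X) has fewer than (t-1)^2 edges, and every block of the vertex partition induced by F (the equivalence classes of the relation u ~ v iff for every X ∈ F, u ∈ X ↔ v ∈ X) has fewer than t vertices. -/
/-- `H` is immersed in `G` via the injective branch-vertex map `φ`:
for each edge `ab` of `H` there is a path in `G` from `φ a` to `φ b`,
and paths corresponding to distinct edges are pairwise edge-disjoint. -/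
def SimpleGraph.ImmersionVia {W V : Type*} (H : SimpleGraph W) (G : SimpleGraph V)
    (φ : W → V) : Prop :=
  Function.Injective φ ∧
  ∃ P : ∀ ⦃a b : W⦄, H.Adj a b → G.Walk (φ a) (φ b),
    (∀ ⦃a b⦄ (h : H.Adj a b), (P h).IsPath) ∧
    (∀ ⦃a b a' b'⦄ (h : H.Adj a b) (h' : H.Adj a' b'),
      s(a, b) ≠ s(a', b') → ∀ e ∈ (P h).edges, e ∉ (P h').edges)

/-- `H` is immersed in `G`. -/
def SimpleGraph.Immersion {W V : Type*} (H : SimpleGraph W) (G : SimpleGraph V) : Prop :=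
  ∃ φ : W → V, H.ImmersionVia G φ

/-- The edge-cut `δ(X)`: edges of `G` with exactly one endpoint in `X`. -/
def SimpleGraph.cutEdges {V : Type*} (G : SimpleGraph V) (X : Set V) : Set (Sym2 V) :=
  {e | e ∈ G.edgeSet ∧ ∃ a b, e = s(a, b) ∧ a ∈ X ∧ b ∉ X}

/-- A family of vertex sets is laminar (pairwise uncrossed). -/
def IsLaminar {V : Type*} (F : Set (Set V)) : Prop :=
  ∀ X ∈ F, ∀ Y ∈ F, X ⊆ Y ∨ X ⊆ Yᶜ ∨ Xᶜ ⊆ Y ∨ Xᶜ ⊆ Yᶜ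

/-- The block containing `v` of the vertex partition induced by the family `F`. -/
def laminarBlock {V : Type*} (F : Set (Set V)) (v : V) : Set V :=
  {u | ∀ X ∈ F, (u ∈ X ↔ v ∈ X)}

/-- A directed path from `x` to `y` in the digraph with adjacency relation `A`,
recorded as its (nonempty, duplicate-free) list of vertices. -/
def IsDiPath {V : Type*} (A : V → V → Prop) (x y : V) (l : List V) : Prop :=
  List.Chain' A l ∧ l.head? = some x ∧ l.getLast? = some y ∧ l.Nodup

/-- The directed edges traversed by a directed walk given by its vertex list. -/
def diWalkEdges {V : Type*} (l : List V) : List (V × V) := l.zip l.tail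

/-- The digraph `F` is immersed in the digraph `A` via the injective map `φ`. -/
def DiImmersionVia {W V : Type*} (F : W → W → Prop) (A : V → V → Prop) (φ : W → V) : Prop :=
  Function.Injective φ ∧
  ∃ P : ∀ ⦃a b : W⦄, F a b → List V,
    (∀ ⦃a b⦄ (h : F a b), IsDiPath A (φ a) (φ b) (P h)) ∧
    (∀ ⦃a b a' b'⦄ (h : F a b) (h' : F a' b'),
      (a, b) ≠ (a', b') → ∀ e ∈ diWalkEdges (P h), e ∉ diWalkEdges (P h'))

/-- The digraph `F` is immersed in the digraph `A`. -/
def DiImmersion {W V : Type*} (F : W → W → Prop) (A : V → V → Prop) : Prop :=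
  ∃ φ : W → V, DiImmersionVia F A φ

/-- The edge-cut `δ(X)` of a digraph: edges with exactly one endpoint in `X`
(in either direction). -/
def diCutEdges {V : Type*} (A : V → V → Prop) (X : Set V) : Set (V × V) :=
  {p | A p.1 p.2 ∧ ¬ (p.1 ∈ X ↔ p.2 ∈ X)}

/-- The outdegree of `v` in the digraph `A`. -/
noncomputable def diOutDeg {V : Type*} (A : V → V → Prop) (v : V) : ℕ := {u | A v u}.ncard

/-- The indegree of `v` in the digraph `A`. -/
noncomputable def diInDeg {V : Type*} (A : V → V → Prop) (v : V) : ℕ := {u | A u v}.ncard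

/-- An Eulerian digraph: loopless, and every vertex has indegree equal to outdegree. -/
def IsEulerianDigraph {V : Type*} (A : V → V → Prop) : Prop :=
  (∀ v, ¬ A v v) ∧ ∀ v : V, diInDeg A v = diOutDeg A v

/-- The bidirected complete digraph `K⃗ₜ` on `Fin t`. -/
def bidirComplete (t : ℕ) : Fin t → Fin t → Prop := fun a b => a ≠ b

/-- Two vertex sets are uncrossed if one of the four corners of their Venn diagram is empty. -/
def Uncrossed {V : Type*} (X Y : Set V) : Prop :=
  X ⊆ Y ∨ X ⊆ Yᶜ ∨ Xᶜ ⊆ Y ∨ Xᶜ ⊆ Yᶜ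

namespace Uncrossed

variable {V : Type*} {X Y Z : Set V}

lemma symm (h : Uncrossed X Y) : Uncrossed Y X := by
  rcases h with h | h | h | h
  · exact .inr (.inr (.inr (Set.compl_subset_compl.2 h)))
  · exact .inr (.inl (Set.subset_compl_comm.1 h))
  · exact .inr (.inr (.inl (Set.compl_subset_comm.1 h)))
  · exact .inl (Set.compl_subset_compl.1 h)

lemma compl_left (h : Uncrossed X Y) : Uncrossed Xᶜ Y := by
  simp only [Uncrossed, compl_compl] at *
  tauto

lemma compl_right (h : Uncrossed X Y) : Uncrossed X Yᶜ :=
  h.symm.compl_left.symm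

lemma union_left (hXY : ¬ Uncrossed X Y) (hX : Uncrossed X Z) (hY : Uncrossed Y Z) :
    Uncrossed (X ∪ Y) Z := by
  simp only [Uncrossed, not_or, Set.not_subset] at hXY
  simp only [Uncrossed, Set.subset_def, Set.mem_compl_iff, Set.mem_union] at *
  obtain ⟨⟨a, ha⟩, ⟨b, hb⟩, ⟨c, hc⟩, ⟨d, hd⟩⟩ := hXY
  rcases hX with h | h | h | h <;> rcases hY with h' | h' | h' | h' <;> grind

end Uncrossed

/-- `X` is a minimum cut, with respect to the cut function `f`, between some pair of vertices. -/
def IsMinCut {V : Type*} (f : Set V → ℕ) (X : Set V) : Prop :=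
  ∃ a b, a ∈ X ∧ b ∉ X ∧ ∀ Z : Set V, a ∈ Z → b ∉ Z → f X ≤ f Z

section SubmodularCuts

variable {V : Type*} {f : Set V → ℕ}

lemma IsMinCut.compl (hc : ∀ X, f Xᶜ = f X) {X : Set V} (h : IsMinCut f X) :
    IsMinCut f Xᶜ := by
  obtain ⟨a, b, ha, hb, hmin⟩ := h
  refine ⟨b, a, hb, by simpa using ha, fun Z hbZ haZ => ?_⟩
  rw [hc, ← hc Z]
  exact hmin Zᶜ haZ (by simpa using hbZ)

lemma exists_uncrossing_of_notMem (hc : ∀ X, f Xᶜ = f X)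
    (hs : ∀ X Y, f (X ∩ Y) + f (X ∪ Y) ≤ f X + f Y) {X Y : Set V} {u v : V}
    (hu : u ∈ X) (hv : v ∉ X) (huY : u ∉ Y) (hvY : v ∉ Y) (hY : IsMinCut f Y)
    (hXY : ¬ Uncrossed X Y) :
    ∃ X', u ∈ X' ∧ v ∉ X' ∧ f X' ≤ f X ∧ Uncrossed X' Y ∧
      ∀ Z, Uncrossed X Z → Uncrossed Y Z → Uncrossed X' Z := by
  obtain ⟨a, b, ha, hb, hmin⟩ := hY
  by_cases haX : a ∈ X
  · refine ⟨X ∪ Y, .inl hu, by simp [hv, hvY], ?_, ?_, fun Z => Uncrossed.union_left hXY⟩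
    · have := hs X Y
      have := hmin (X ∩ Y) ⟨haX, ha⟩ (fun h => hb h.2)
      omega
    · exact Uncrossed.symm (.inl Set.subset_union_right)
  · have hXY' : ¬ Uncrossed Xᶜ Y := fun h => hXY (by simpa using h.compl_left)
    refine ⟨(Xᶜ ∪ Y)ᶜ, by simp [hu, huY], by simp [hv], ?_, ?_,
      fun Z h h' => (Uncrossed.union_left hXY' h.compl_left h').compl_left⟩
    · have := hs Xᶜ Y
      have := hmin (Xᶜ ∩ Y) ⟨haX, ha⟩ (fun h => hb h.2)
      rw [hc X] at *
      rw [hc]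
      omega
    · exact .inr (.inl (Set.compl_subset_compl.2 Set.subset_union_right))

lemma exists_uncrossing (hc : ∀ X, f Xᶜ = f X)
    (hs : ∀ X Y, f (X ∩ Y) + f (X ∪ Y) ≤ f X + f Y) {X Y : Set V} {u v : V}
    (hu : u ∈ X) (hv : v ∉ X) (huv : u ∈ Y ↔ v ∈ Y) (hY : IsMinCut f Y)
    (hXY : ¬ Uncrossed X Y) :
    ∃ X', u ∈ X' ∧ v ∉ X' ∧ f X' ≤ f X ∧ Uncrossed X' Y ∧
      ∀ Z, Uncrossed X Z → Uncrossed Y Z → Uncrossed X' Z := by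
  by_cases huY : u ∈ Y
  · obtain ⟨X', h₁, h₂, h₃, h₄, h₅⟩ := exists_uncrossing_of_notMem hc hs hu hv
      (Y := Yᶜ) (by simpa using huY) (by simpa using huv.1 huY) (hY.compl hc)
      (fun h => hXY (by simpa using h.compl_right))
    exact ⟨X', h₁, h₂, h₃, by simpa using h₄.compl_right,
      fun Z h h' => h₅ Z h h'.compl_left⟩
  · exact exists_uncrossing_of_notMem hc hs hu hv huY (fun h => huY (huv.2 h)) hY hXY

/-- A symmetric submodular function on a finite set admits a laminar family of cuts of value
less than `k` which separates every pair of vertices that some such cut separates. -/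
theorem exists_isLaminar_separating [Finite V] (hc : ∀ X, f Xᶜ = f X)
    (hs : ∀ X Y, f (X ∩ Y) + f (X ∪ Y) ≤ f X + f Y) (k : ℕ) :
    ∃ F : Set (Set V), IsLaminar F ∧ (∀ X ∈ F, f X < k) ∧
      ∀ u v, (∀ X ∈ F, u ∈ X ↔ v ∈ X) → ∀ X : Set V, u ∈ X → v ∉ X → k ≤ f X := by
  obtain ⟨F, ⟨hlam, hF⟩, hmax⟩ := Set.exists_max_image
    {F : Set (Set V) | IsLaminar F ∧ ∀ X ∈ F, f X < k ∧ IsMinCut f X} Set.ncard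
    (Set.toFinite _) ⟨∅, by simp [IsLaminar]⟩
  refine ⟨F, hlam, fun X hX => (hF X hX).1, fun u v huv X₀ hu₀ hv₀ => ?_⟩
  by_contra! hlt
  obtain ⟨X₁, ⟨hu₁, hv₁⟩, hmin₁⟩ := Set.exists_min_image {X : Set V | u ∈ X ∧ v ∉ X} f
    (Set.toFinite _) ⟨X₀, hu₀, hv₀⟩
  obtain ⟨X, ⟨hu, hv, hle⟩, hcross⟩ := Set.exists_min_image
    {X : Set V | u ∈ X ∧ v ∉ X ∧ f X ≤ f X₁} (fun X => {Z ∈ F | ¬ Uncrossed X Z}.ncard)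
    (Set.toFinite _) ⟨X₁, hu₁, hv₁, le_rfl⟩
  have hXF : X ∉ F := fun h => hv ((huv X h).1 hu)
  have hXlt : f X < k := (hle.trans (hmin₁ X₀ ⟨hu₀, hv₀⟩)).trans_lt hlt
  by_cases hall : ∀ Y ∈ F, Uncrossed X Y
  · have hins := hmax (insert X F) ⟨?_, ?_⟩
    · rw [Set.ncard_insert_of_notMem hXF] at hins
      omega
    · rintro Y (rfl | hY) Z (rfl | hZ)
      · exact .inl subset_rfl
      · exact hall Z hZ
      · exact (hall Y hY).symm
      · exact hlam Y hY Z hZ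
    · rintro Y (rfl | hY)
      · exact ⟨hXlt, u, v, hu, hv, fun Z hZ hZ' => hle.trans (hmin₁ Z ⟨hZ, hZ'⟩)⟩
      · exact hF Y hY
  · push Not at hall
    obtain ⟨Y, hY, hXY⟩ := hall
    obtain ⟨X', hu', hv', hle', hX'Y, hX'⟩ :=
      exists_uncrossing hc hs hu hv (huv Y hY) (hF Y hY).2 hXY
    refine (hcross X' ⟨hu', hv', hle'.trans hle⟩).not_gt (Set.ncard_lt_ncard ?_)
    refine ⟨fun Z hZ => ⟨hZ.1, fun h => hZ.2 (hX' Z h (hlam Y hY Z hZ.1))⟩, fun h => ?_⟩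
    exact (h (show Y ∈ {Z ∈ F | ¬ Uncrossed X Z} from ⟨hY, hXY⟩)).2 hX'Y

end SubmodularCuts

section ArcDisjointWalks

open Classical in
/-- The arcs of `A` that leave the vertex set `U`. -/
noncomputable def arcsOut {V : Type*} (A : Finset (V × V)) (U : Set V) : Finset (V × V) :=
  {p ∈ A | p.1 ∈ U ∧ p.2 ∉ U}

open Classical in
/-- The number of indices `i` whose starting vertex `s i` lies in `U`. -/
noncomputable def demand {V ι : Type*} [Fintype ι] (s : ι → V) (U : Set V) : ℕ :=
  Finset.card {i | s i ∈ U}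

variable {V ι : Type*} [Fintype ι]

@[simp]
lemma mem_arcsOut {A : Finset (V × V)} {U : Set V} {p : V × V} :
    p ∈ arcsOut A U ↔ p ∈ A ∧ p.1 ∈ U ∧ p.2 ∉ U := by
  simp [arcsOut]

lemma card_arcsOut_submodular (A : Finset (V × V)) (T U : Set V) :
    (arcsOut A (T ∩ U)).card + (arcsOut A (T ∪ U)).card ≤
      (arcsOut A T).card + (arcsOut A U).card := by
  classical
  rw [← Finset.card_union_add_card_inter, ← Finset.card_union_add_card_inter (arcsOut A T)]
  apply Nat.add_le_add <;> apply Finset.card_le_card <;> intro p <;> simp <;> tauto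

lemma card_arcsOut_submodular_strict {A : Finset (V × V)} {T U : Set V} {x y : V}
    (hA : (x, y) ∈ A) (hxT : x ∈ T) (hyT : y ∉ T) (hyU : y ∈ U) (hxU : x ∉ U) :
    (arcsOut A (T ∩ U)).card + (arcsOut A (T ∪ U)).card <
      (arcsOut A T).card + (arcsOut A U).card := by
  classical
  rw [← Finset.card_union_add_card_inter, ← Finset.card_union_add_card_inter (arcsOut A T)]
  refine Nat.add_lt_add_of_lt_of_le (Finset.card_lt_card ?_) (Finset.card_le_card ?_)
  · refine ⟨fun p => by simp; tauto, fun h => ?_⟩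
    have := h (show (x, y) ∈ arcsOut A T ∪ arcsOut A U by simp [*])
    simp [*] at this
  · intro p
    simp
    tauto

lemma demand_inter_add_union (s : ι → V) (T U : Set V) :
    demand s (T ∩ U) + demand s (T ∪ U) = demand s T + demand s U := by
  classical
  simp only [demand]
  rw [← Finset.card_union_add_card_inter (Finset.univ.filter fun i => s i ∈ T), add_comm]
  congr 2 <;> ext i <;> simp

/-- Every set avoiding `r` has enough outgoing arcs for the walks that start inside it. -/
def Feasible (A : Finset (V × V)) (s : ι → V) (r : V) : Prop :=
  ∀ U : Set V, r ∉ U → demand s U ≤ (arcsOut A U).card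

/-- In a feasible instance, no arc can leave one tight set and enter another. -/
lemma Feasible.not_tight {A : Finset (V × V)} {s : ι → V} {r : V} (h : Feasible A s r)
    {T U : Set V} {x y : V} (hA : (x, y) ∈ A) (hxT : x ∈ T) (hyT : y ∉ T) (hyU : y ∈ U)
    (hxU : x ∉ U) (hrT : r ∉ T) (hrU : r ∉ U) (hT : (arcsOut A T).card ≤ demand s T)
    (hU : (arcsOut A U).card ≤ demand s U) : False := by
  have h₁ := card_arcsOut_submodular_strict hA hxT hyT hyU hxU
  have h₂ := demand_inter_add_union s T U
  have h₃ := h (T ∩ U) (fun h => hrT h.1)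
  have h₄ := h (T ∪ U) (by simp [hrT, hrU])
  omega

open Classical in
lemma card_arcsOut_erase {A : Finset (V × V)} {p : V × V} (hp : p ∈ A) (U : Set V) :
    (arcsOut (A.erase p) U).card + (if p.1 ∈ U ∧ p.2 ∉ U then 1 else 0) =
      (arcsOut A U).card := by
  have : arcsOut (A.erase p) U = (arcsOut A U).erase p := by ext; simp; tauto
  rw [this]
  split_ifs with h
  · exact Finset.card_erase_add_one (by simp [hp, h])
  · rw [Finset.erase_eq_of_notMem (by simp; tauto), add_zero]

open Classical in
/-- If deleting the arc `(x, y)` destroys feasibility, it leaves a tight set. -/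
lemma Feasible.exists_tight {A : Finset (V × V)} {s : ι → V} {r x y : V} (h : Feasible A s r)
    (hA : (x, y) ∈ A) (hdel : ¬ Feasible (A.erase (x, y)) s r) :
    ∃ T : Set V, r ∉ T ∧ x ∈ T ∧ y ∉ T ∧ (arcsOut A T).card ≤ demand s T := by
  unfold Feasible at hdel
  push Not at hdel
  obtain ⟨T, hrT, hT⟩ := hdel
  have h₁ := card_arcsOut_erase hA T
  have h₂ := h T hrT
  split_ifs at h₁ with h₃
  · exact ⟨T, hrT, h₃.1, h₃.2, by omega⟩
  · omega

/-- A feasible set of arcs contains a feasible set without pairs of opposite arcs. -/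
lemma Feasible.exists_oriented {s : ι → V} {r : V} :
    ∀ (A : Finset (V × V)), Feasible A s r →
      ∃ B ⊆ A, Feasible B s r ∧ ∀ x y, x ≠ y → (x, y) ∈ B → (y, x) ∉ B := by
  classical
  intro A
  induction A using Finset.strongInduction with
  | H A ih =>
    intro h
    by_cases hdel : ∃ p ∈ A, Feasible (A.erase p) s r
    · obtain ⟨p, hp, hdel⟩ := hdel
      obtain ⟨B, hB, hB'⟩ := ih _ (Finset.erase_ssubset hp) hdel
      exact ⟨B, hB.trans (Finset.erase_subset _ _), hB'⟩
    · push Not at hdel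
      refine ⟨A, subset_rfl, h, fun x y _ hxy hyx => ?_⟩
      obtain ⟨T, hrT, hxT, hyT, hT⟩ := h.exists_tight hxy (hdel _ hxy)
      obtain ⟨U, hrU, hyU, hxU, hU⟩ := h.exists_tight hyx (hdel _ hyx)
      exact h.not_tight hxy hxT hyT hyU hxU hrT hrU hT hU

/-- A feasible instance has a system of arc-disjoint walks to `r`; the arc `d` is used only by
the walk with index `c d`. -/
lemma Feasible.exists_walks {G : SimpleGraph V} {r : V} (A : Finset (V × V)) :
    ∀ s : ι → V, Feasible A s r → (∀ p ∈ A, G.Adj p.1 p.2) →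
      ∃ c : V × V → Option ι, ∀ i, ∃ p : G.Walk (s i) r,
        ∀ d ∈ p.darts, d.toProd ∈ A ∧ c d.toProd = some i := by
  classical
  induction A using Finset.strongInduction with
  | H A ih =>
    intro s h hG
    by_cases hs : ∀ i, s i = r
    · exact ⟨fun _ => none, fun i => ⟨SimpleGraph.Walk.nil.copy rfl (hs i), by simp⟩⟩
    push Not at hs
    obtain ⟨i, hi⟩ := hs
    have hpos : 0 < (arcsOut A {s i}).card := by
      refine lt_of_lt_of_le ?_ (h {s i} (by simpa using hi.symm))
      exact Finset.card_pos.2 ⟨i, by simp⟩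
    obtain ⟨⟨x, y⟩, hxy⟩ := Finset.card_pos.1 hpos
    obtain ⟨hA, rfl, hy⟩ := by simpa only [mem_arcsOut, Set.mem_singleton_iff] using hxy
    have hG' : ∀ p ∈ A.erase (s i, y), G.Adj p.1 p.2 :=
      fun p hp => hG p (Finset.mem_of_mem_erase hp)
    by_cases hdel : Feasible (A.erase (s i, y)) s r
    · obtain ⟨c, hc⟩ := ih _ (Finset.erase_ssubset hA) s hdel hG'
      refine ⟨c, fun j => ?_⟩
      obtain ⟨p, hp⟩ := hc j
      exact ⟨p, fun d hd => ⟨Finset.mem_of_mem_erase (hp d hd).1, (hp d hd).2⟩⟩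
    obtain ⟨T, hrT, hxT, hyT, hT⟩ := h.exists_tight hA hdel
    have hmove : Feasible (A.erase (s i, y)) (Function.update s i y) r := by
      intro U hrU
      have h₁ := card_arcsOut_erase hA U
      have h₂ := h U hrU
      have h₃ : demand (Function.update s i y) U + (if s i ∈ U then 1 else 0) =
          demand s U + (if y ∈ U then 1 else 0) := by
        simp only [demand, Finset.card_filter]
        rw [← Finset.add_sum_erase _ _ (Finset.mem_univ i),
          ← Finset.add_sum_erase (a := i) _ (fun j => if s j ∈ U then 1 else 0)
            (Finset.mem_univ i)]
        rw [Finset.sum_congr rfl (g := fun j => if s j ∈ U then 1 else 0) (fun j hj => by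
          rw [Function.update_of_ne (Finset.ne_of_mem_erase hj)])]
        simp only [Function.update_self]
        omega
      by_cases hxU : s i ∈ U <;> by_cases hyU : y ∈ U <;> simp [hxU, hyU] at h₁ h₃
      · omega
      · omega
      · have : ¬ (arcsOut A U).card ≤ demand s U :=
          fun hU => h.not_tight hA hxT hyT hyU hxU hrT hrU hT hU
        omega
      · omega
    obtain ⟨c, hc⟩ := ih _ (Finset.erase_ssubset hA) _ hmove hG'
    refine ⟨Function.update c (s i, y) (some i), fun j => ?_⟩
    obtain ⟨p, hp⟩ := hc j
    have hp' : ∀ d ∈ p.darts, d.toProd ∈ A ∧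
        Function.update c (s i, y) (some i) d.toProd = some j := fun d hd => by
      obtain ⟨hdA, hdc⟩ := hp d hd
      exact ⟨Finset.mem_of_mem_erase hdA, by
        rw [Function.update_of_ne (Finset.ne_of_mem_erase hdA), hdc]⟩
    by_cases hj : j = i
    · subst hj
      refine ⟨.cons (hG _ hA) (p.copy (by simp) rfl), fun d hd => ?_⟩
      simp only [SimpleGraph.Walk.darts_cons, SimpleGraph.Walk.darts_copy, List.mem_cons] at hd
      rcases hd with rfl | hd
      · exact ⟨hA, by simp⟩
      · exact hp' d hd
    · exact ⟨p.copy (by simp [hj]) rfl, by simpa using hp'⟩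

end ArcDisjointWalks

namespace SimpleGraph

variable {V : Type*} (G : SimpleGraph V)

open Classical in
lemma ncard_cutEdges [Fintype V] (X : Set V) :
    (G.cutEdges X).ncard = (arcsOut {p : V × V | G.Adj p.1 p.2} X).card := by
  rw [← Set.ncard_coe_finset]
  symm
  refine Set.ncard_congr (fun p _ => s(p.1, p.2)) ?_ ?_ ?_
  · rintro ⟨x, y⟩ h
    simp at h
    exact ⟨h.1, x, y, rfl, h.2⟩
  · rintro ⟨x, y⟩ ⟨x', y'⟩ h h' he
    simp at h h' he
    grind
  · rintro e ⟨he, a, b, rfl, ha, hb⟩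
    exact ⟨(a, b), by simpa [ha, hb] using he, rfl⟩

lemma ncard_cutEdges_compl (X : Set V) : (G.cutEdges Xᶜ).ncard = (G.cutEdges X).ncard := by
  congr 1
  ext e
  constructor <;> rintro ⟨he, a, b, rfl, ha, hb⟩
  · exact ⟨he, b, a, Sym2.eq_swap, by simpa using hb, ha⟩
  · exact ⟨he, b, a, Sym2.eq_swap, hb, by simpa using ha⟩

variable {G} in
/-- Edge-disjoint walks to a common root `r`: if every vertex set avoiding `r` is left by at least
as many edges as there are starting vertices in it, such walks exist. -/
theorem exists_edgeDisjoint_walks [Fintype V] {ι : Type*} [Fintype ι] {s : ι → V} {r : V}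
    (h : ∀ U : Set V, r ∉ U → demand s U ≤ (G.cutEdges U).ncard) :
    ∃ p : ∀ i, G.Walk (s i) r, ∀ i j, ∀ e ∈ (p i).edges, e ∈ (p j).edges → i = j := by
  classical
  obtain ⟨B, hBA, hB, hor⟩ := Feasible.exists_oriented {p : V × V | G.Adj p.1 p.2}
    (s := s) (r := r) (fun U hU => (h U hU).trans_eq (G.ncard_cutEdges U))
  have hBG : ∀ p ∈ B, G.Adj p.1 p.2 := fun p hp => by simpa using hBA hp
  obtain ⟨c, hc⟩ := hB.exists_walks B s hBG
  choose p hp using hc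
  refine ⟨p, fun i j e hi hj => ?_⟩
  simp only [Walk.edges, List.mem_map] at hi hj
  obtain ⟨d, hd, rfl⟩ := hi
  obtain ⟨d', hd', he⟩ := hj
  obtain ⟨hdB, hdc⟩ := hp i d hd
  obtain ⟨hdB', hdc'⟩ := hp j d' hd'
  rcases dart_edge_eq_iff d' d |>.1 he with rfl | rfl
  · exact Option.some_injective _ (hdc.symm.trans hdc')
  · exact absurd hdB' (hor _ _ d.adj.ne hdB)

variable {G} in
/-- A graph with `n + 1` vertices pairwise not separated by fewer than `n ^ 2` edges admits an
immersion of the complete graph on `n + 1` vertices. -/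
theorem immersion_top_of_edgeConnected [Fintype V] {n : ℕ} (φ : Fin (n + 1) → V)
    (hφ : Function.Injective φ)
    (h : ∀ (a b) (X : Set V), φ a ∈ X → φ b ∉ X → n ^ 2 ≤ (G.cutEdges X).ncard) :
    (⊤ : SimpleGraph (Fin (n + 1))).Immersion G := by
  classical
  obtain ⟨p, hp⟩ := exists_edgeDisjoint_walks (G := G)
    (s := fun q : Fin n × Fin n => φ q.1.castSucc) (r := φ (Fin.last n)) (by
      intro U hU
      by_cases hne : ∃ i : Fin n, φ i.castSucc ∈ U
      · obtain ⟨i, hi⟩ := hne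
        refine le_trans ?_ (h _ _ U hi hU)
        exact (Finset.card_le_univ _).trans_eq (by simp [sq])
      · push Not at hne
        simp [demand, hne])
  have key : ∀ a b : Fin (n + 1), a ≠ b → ∃ w : G.Walk (φ a) (φ b), ∀ e ∈ w.edges,
      ∃ q : Fin n × Fin n, e ∈ (p q).edges ∧
        s(a, b) = s(q.1.castSucc, if q.1 = q.2 then Fin.last n else q.2.castSucc) := by
    intro a b hab
    induction a using Fin.lastCases with
    | last =>
      induction b using Fin.lastCases with
      | last => exact absurd rfl hab
      | cast b =>
        refine ⟨(p (b, b)).reverse, fun e he => ⟨(b, b), by simpa using he, ?_⟩⟩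
        simp [Sym2.eq_swap]
    | cast a =>
      induction b using Fin.lastCases with
      | last => exact ⟨p (a, a), fun e he => ⟨(a, a), he, by simp⟩⟩
      | cast b =>
        have hab' : a ≠ b := fun h => hab (by rw [h])
        refine ⟨(p (a, b)).append (p (b, a)).reverse, fun e he => ?_⟩
        simp only [Walk.edges_append, Walk.edges_reverse, List.mem_append,
          List.mem_reverse] at he
        rcases he with he | he
        · exact ⟨(a, b), he, by simp [hab']⟩
        · exact ⟨(b, a), he, by simp [hab'.symm, Sym2.eq_swap]⟩
  choose w hw using key
  refine ⟨φ, hφ, fun a b hab => (w a b hab.ne).bypass, fun a b hab => Walk.bypass_isPath _, ?_⟩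
  intro a b a' b' hab hab' hne e he he'
  obtain ⟨q, hq, hq'⟩ := hw a b hab.ne e (Walk.edges_bypass_subset_edges _ he)
  obtain ⟨q₂, hq₂, hq₂'⟩ := hw a' b' hab'.ne e (Walk.edges_bypass_subset_edges _ he')
  obtain rfl := hp _ _ e hq hq₂
  exact hne (hq'.trans hq₂'.symm)

end SimpleGraph

/-- Every finite simple graph with no `K_t`-immersion admits a laminar
family of edge-cuts of size `< (t-1)^2` whose induced vertex partition has all blocks
of size `< t`. -/
theorem stmt_0 {V : Type*} [Fintype V] (t : ℕ) (ht : 1 ≤ t) (G : SimpleGraph V)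
    (hG : ¬ SimpleGraph.Immersion (⊤ : SimpleGraph (Fin t)) G) :
    ∃ F : Set (Set V), IsLaminar F ∧
      (∀ X ∈ F, (G.cutEdges X).ncard < (t - 1) ^ 2) ∧
      (∀ v : V, (laminarBlock F v).ncard < t) := by
  obtain ⟨n, rfl⟩ := Nat.exists_eq_add_of_le' ht
  rw [Nat.add_sub_cancel]
  obtain ⟨F, hlam, hlt, hsep⟩ := exists_isLaminar_separating
    (f := fun X => (G.cutEdges X).ncard) G.ncard_cutEdges_compl
    (fun X Y => by simpa only [G.ncard_cutEdges] using card_arcsOut_submodular _ X Y) (n ^ 2)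
  refine ⟨F, hlam, hlt, fun v => ?_⟩
  by_contra! hcard
  obtain ⟨B, hB, hBcard⟩ := Set.exists_subset_card_eq hcard
  let e : Fin (n + 1) ≃ B := (Finite.equivFinOfCardEq hBcard).symm
  refine hG (SimpleGraph.immersion_top_of_edgeConnected (fun a => (e a : V))
    (Subtype.val_injective.comp e.injective) fun a b X ha hb => ?_)
  exact hsep _ _ (fun Z hZ => (hB (e a).2 Z hZ).trans (hB (e b).2 Z hZ).symm) X ha hb
end

section
/- Let t ≥ 1 be an integer and let D be a finite simple Eulerian digraph (loopless, at most one edge from x to y for each ordered pair, every vertex has indegree equal to outdegree) that does not contain an immersion of the bidirected complete digraph K⃗_t. Then there exists a laminar family F of subsets of V(D) such that for every X ∈ F the edge-cut δ(X) has fewer than 2t(t-1) edges, and every block of the vertex partition induced by F (the equivalence classes of the relation u ~ v iff for every X ∈ F, u ∈ X ↔ v ∈ X) has fewer than t vertices. -/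
section Laminar

variable {V : Type*}

/-- `X` attains the least value of `g` among the sets separating `u` from `v`. -/
def IsMinSeparator (g : Set V → ℕ) (u v : V) (X : Set V) : Prop :=
  ¬ (u ∈ X ↔ v ∈ X) ∧ ∀ Y : Set V, ¬ (u ∈ Y ↔ v ∈ Y) → g X ≤ g Y

/-- Minimum separators of a symmetric submodular function do not cross, provided that the
function takes different values on different bipartitions. -/
theorem IsMinSeparator.uncrossed {g : Set V → ℕ}
    (hsub : ∀ X Y, g (X ∩ Y) + g (X ∪ Y) ≤ g X + g Y) (hsymm : ∀ X, g Xᶜ = g X)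
    (hinj : ∀ X Y, g X = g Y → X = Y ∨ X = Yᶜ) {u v a b : V} {X Y : Set V}
    (hX : IsMinSeparator g u v X) (hY : IsMinSeparator g a b Y) :
    X ⊆ Y ∨ X ⊆ Yᶜ ∨ Xᶜ ⊆ Y ∨ Xᶜ ⊆ Yᶜ := by
  have key : ∀ P Q : Set V, ¬ (u ∈ P ↔ v ∈ P) → ¬ (a ∈ Q ↔ b ∈ Q) →
      g P + g Q ≤ g X + g Y → P = X ∨ P = Xᶜ := by
    intro P Q hP hQ h
    have h1 := hX.2 P hP
    have h2 := hY.2 Q hQ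
    exact hinj _ _ (by omega)
  have h1 := hsub X Y
  have h2 := hsub X Yᶜ
  rw [hsymm Y] at h2
  have k1 := key (X ∩ Y) (X ∪ Y)
  have k2 := key (X ∪ Y) (X ∩ Y)
  have k3 := key (X ∩ Yᶜ) (X ∪ Yᶜ)
  have k4 := key (X ∪ Yᶜ) (X ∩ Yᶜ)
  have k5 : ¬ (a ∈ X ↔ b ∈ X) → ¬ (u ∈ Y ↔ v ∈ Y) → X = Y ∨ X = Yᶜ := fun p q =>
    hinj _ _ (le_antisymm (hX.2 Y q) (hY.2 X p))
  have hcases : (X ∩ Y = X ∨ X ∩ Y = Xᶜ) ∨ (X ∪ Y = X ∨ X ∪ Y = Xᶜ) ∨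
      (X ∩ Yᶜ = X ∨ X ∩ Yᶜ = Xᶜ) ∨ (X ∪ Yᶜ = X ∨ X ∪ Yᶜ = Xᶜ) ∨ (X = Y ∨ X = Yᶜ) := by
    have hu := hX.1
    have ha := hY.1
    by_contra! hc
    simp only [Set.mem_inter_iff, Set.mem_union, Set.mem_compl_iff] at k1 k2 k3 k4
    by_cases u ∈ X <;> by_cases v ∈ X <;> by_cases a ∈ X <;> by_cases b ∈ X <;>
      by_cases u ∈ Y <;> by_cases v ∈ Y <;> by_cases a ∈ Y <;> by_cases b ∈ Y <;>
      grind
  simp only [Set.ext_iff, Set.subset_def, Set.mem_inter_iff, Set.mem_union,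
    Set.mem_compl_iff] at hcases ⊢
  rcases hcases with (h | h) | (h | h) | (h | h) | (h | h) | (h | h) <;> grind

open Classical in
/-- The total weight of the pairs separated by `X`. -/
noncomputable def cutWeight [Fintype V] (c : V × V → ℕ) (X : Set V) : ℕ :=
  ∑ p : V × V, if (p.1 ∈ X ↔ p.2 ∈ X) then 0 else c p

theorem cutWeight_compl [Fintype V] (c : V × V → ℕ) (X : Set V) :
    cutWeight c Xᶜ = cutWeight c X := by
  refine Finset.sum_congr rfl fun p _ => ?_
  have hc (v) : v ∈ Xᶜ ↔ v ∉ X := Iff.rfl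
  by_cases p.1 ∈ X <;> by_cases p.2 ∈ X <;> simp_all

theorem cutWeight_submodular [Fintype V] (c : V × V → ℕ) (X Y : Set V) :
    cutWeight c (X ∩ Y) + cutWeight c (X ∪ Y) ≤ cutWeight c X + cutWeight c Y := by
  simp only [cutWeight, ← Finset.sum_add_distrib]
  refine Finset.sum_le_sum fun p _ => ?_
  have hi (v) : v ∈ X ∩ Y ↔ v ∈ X ∧ v ∈ Y := Iff.rfl
  have hu (v) : v ∈ X ∪ Y ↔ v ∈ X ∨ v ∈ Y := Iff.rfl
  by_cases p.1 ∈ X <;> by_cases p.2 ∈ X <;> by_cases p.1 ∈ Y <;> by_cases p.2 ∈ Y <;>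
    simp_all

theorem cutWeight_add_smul [Fintype V] (m : ℕ) (c d : V × V → ℕ) (X : Set V) :
    cutWeight (fun p => m * c p + d p) X = m * cutWeight c X + cutWeight d X := by
  classical
  simp only [cutWeight, Finset.mul_sum, ← Finset.sum_add_distrib]
  refine Finset.sum_congr rfl fun p _ => ?_
  split_ifs <;> simp

open Classical in
/-- Weights on the pairs `(v, r)` for which distinct bipartitions get distinct cut weights. -/
noncomputable def starWeight [Fintype V] (r : V) (p : V × V) : ℕ :=
  if p.2 = r then 2 ^ (Fintype.equivFin V p.1 : ℕ) else 0

open Classical in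
theorem cutWeight_starWeight [Fintype V] (r : V) (X : Set V) :
    cutWeight (starWeight r) X =
      ∑ i ∈ (Finset.univ.filter fun v => ¬ (v ∈ X ↔ r ∈ X)).map
        ((Fintype.equivFin V).toEmbedding.trans Fin.valEmbedding), 2 ^ i := by
  rw [Finset.sum_map, Finset.sum_filter, cutWeight, Fintype.sum_prod_type]
  refine Finset.sum_congr rfl fun v _ => ?_
  rw [Finset.sum_eq_single r]
  · by_cases h : v ∈ X ↔ r ∈ X <;> simp [h, starWeight]
  · intro w _ hw
    simp [starWeight, hw]
  · simp

theorem cutWeight_starWeight_lt [Fintype V] (r : V) (X : Set V) :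
    cutWeight (starWeight r) X < 2 ^ Fintype.card V := by
  classical
  rw [cutWeight_starWeight]
  refine Nat.geomSum_lt le_rfl fun i hi => ?_
  simp only [Finset.mem_map] at hi
  obtain ⟨v, -, rfl⟩ := hi
  simp

theorem eq_or_eq_compl_of_cutWeight_starWeight_eq [Fintype V] (r : V) {X Y : Set V}
    (h : cutWeight (starWeight r) X = cutWeight (starWeight r) Y) : X = Y ∨ X = Yᶜ := by
  classical
  rw [cutWeight_starWeight, cutWeight_starWeight] at h
  have h' := Finset.map_injective _ (Finset.geomSum_injective le_rfl h)
  simp only [Finset.ext_iff, Finset.mem_filter, Finset.mem_univ, true_and] at h'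
  by_cases hX : r ∈ X <;> by_cases hY : r ∈ Y <;> simp only [hX, hY] at h' <;>
    [left; right; right; left] <;> ext v <;> have := h' v <;> simp at this ⊢ <;> tauto

open Classical in
theorem ncard_diCutEdges_eq_cutWeight [Fintype V] (A : V → V → Prop) (X : Set V) :
    (diCutEdges A X).ncard = cutWeight (fun p => if A p.1 p.2 then 1 else 0) X := by
  rw [Set.ncard_eq_toFinset_card', cutWeight, diCutEdges, Set.toFinset_ofPred,
    Finset.card_filter]
  refine Finset.sum_congr rfl fun p _ => ?_
  by_cases h : p.1 ∈ X ↔ p.2 ∈ X <;> simp [h]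

/-- A threshold form of the Gomory–Hu theorem: some laminar family of cuts of weight less
than `k` separates all pairs of vertices that can be separated by such a cut. -/
theorem exists_laminar_separating [Fintype V] (c : V × V → ℕ) (k : ℕ) :
    ∃ F : Set (Set V), IsLaminar F ∧ (∀ X ∈ F, cutWeight c X < k) ∧
      ∀ u v, u ∈ laminarBlock F v → ∀ X, cutWeight c X < k → (u ∈ X ↔ v ∈ X) := by
  classical
  rcases isEmpty_or_nonempty V with hV | ⟨⟨r⟩⟩
  · exact ⟨∅, by simp [IsLaminar], by simp, fun u => (hV.false u).elim⟩
  set M := 2 ^ Fintype.card V with hM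
  set g : Set V → ℕ := cutWeight fun p => M * c p + starWeight r p with hg
  have hgeq (X) : g X = M * cutWeight c X + cutWeight (starWeight r) X :=
    cutWeight_add_smul ..
  have hlt (X : Set V) : cutWeight (starWeight r) X < M := cutWeight_starWeight_lt r X
  have hmod (X) : g X % M = cutWeight (starWeight r) X := by
    rw [hgeq, Nat.mul_add_mod, Nat.mod_eq_of_lt (hlt X)]
  have hdiv (X) : g X / M = cutWeight c X := by
    rw [hgeq, Nat.mul_add_div (by positivity), Nat.div_eq_of_lt (hlt X), add_zero]
  have hinj (X Y) (h : g X = g Y) : X = Y ∨ X = Yᶜ :=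
    eq_or_eq_compl_of_cutWeight_starWeight_eq r (by rw [← hmod, ← hmod, h])
  refine ⟨{X | (∃ u v, IsMinSeparator g u v X) ∧ cutWeight c X < k}, ?_, fun X hX => hX.2, ?_⟩
  · rintro X ⟨⟨u, v, hX⟩, -⟩ Y ⟨⟨a, b, hY⟩, -⟩
    exact hX.uncrossed (cutWeight_submodular _) (cutWeight_compl _) hinj hY
  · intro u v huv X hX
    by_contra hsep
    obtain ⟨Y, hY, hmin⟩ := Set.exists_min_image {Y : Set V | ¬ (u ∈ Y ↔ v ∈ Y)} g
      (Set.toFinite _) ⟨X, hsep⟩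
    refine hY (huv Y ⟨⟨u, v, hY, hmin⟩, lt_of_le_of_lt ?_ hX⟩)
    rw [← hdiv, ← hdiv]
    exact Nat.div_le_div_right (hmin X hsep)

end Laminar

section Path

variable {V : Type*}

theorem exists_isDiPath_of_reflTransGen {A : V → V → Prop} {x y : V}
    (h : Relation.ReflTransGen A x y) : ∃ l, IsDiPath A x y l := by
  induction h using Relation.ReflTransGen.head_induction_on with
  | refl => exact ⟨[y], List.isChain_singleton _, by simp⟩
  | @head a b hab _ ih =>
    obtain ⟨l, hchain, hhead, hlast, hnd⟩ := ih
    by_cases ha : a ∈ l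
    · obtain ⟨l₁, l₂, rfl⟩ := List.append_of_mem ha
      refine ⟨a :: l₂, hchain.right_of_append, by simp, ?_, hnd.of_append_right⟩
      simpa using hlast
    · cases l with
      | nil => simp at hhead
      | cons b' l =>
        simp only [List.head?_cons, Option.some.injEq] at hhead
        subst hhead
        refine ⟨a :: b' :: l, ?_, by simp, by simpa using hlast, List.nodup_cons.2 ⟨ha, hnd⟩⟩
        exact List.isChain_cons_cons.2 ⟨hab, hchain⟩

theorem rel_of_mem_diWalkEdges {A : V → V → Prop} {l : List V} (h : List.IsChain A l)
    {e : V × V} (he : e ∈ diWalkEdges l) : A e.1 e.2 := by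
  induction l with
  | nil => simp [diWalkEdges] at he
  | cons a l ih =>
    cases l with
    | nil => simp [diWalkEdges] at he
    | cons b l =>
      rw [List.isChain_cons_cons] at h
      simp only [diWalkEdges, List.tail_cons, List.zip_cons_cons, List.mem_cons] at he
      rcases he with rfl | he
      · exact h.1
      · exact ih h.2 he

end Path

section Flow

variable {V : Type*} [DecidableEq V]

/-- The number of edges of `E` leaving `X`. -/
def outCut (E : Finset (V × V)) (X : Finset V) : ℤ :=
  ∑ e ∈ E, if e.1 ∈ X ∧ e.2 ∉ X then 1 else 0

/-- The outdegree of `v` minus its indegree in the edge set `E`. -/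
def excess (E : Finset (V × V)) (v : V) : ℤ :=
  ∑ e ∈ E, ((if e.1 = v then 1 else 0) - if e.2 = v then 1 else 0)

theorem outCut_nonneg (E : Finset (V × V)) (X : Finset V) : 0 ≤ outCut E X :=
  Finset.sum_nonneg fun _ _ => by split_ifs <;> simp

theorem sum_excess (E : Finset (V × V)) (X : Finset V) :
    ∑ v ∈ X, excess E v =
      ∑ e ∈ E, ((if e.1 ∈ X then 1 else 0) - if e.2 ∈ X then 1 else 0) := by
  simp only [excess]
  rw [Finset.sum_comm]
  simp

theorem sum_excess_le_outCut (E : Finset (V × V)) (X : Finset V) :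
    ∑ v ∈ X, excess E v ≤ outCut E X := by
  rw [sum_excess]
  refine Finset.sum_le_sum fun e _ => ?_
  by_cases e.1 ∈ X <;> by_cases e.2 ∈ X <;> simp_all

theorem excess_union {S T : Finset (V × V)} (h : Disjoint S T) (v : V) :
    excess (S ∪ T) v = excess S v + excess T v :=
  Finset.sum_union h

theorem excess_sdiff {S T : Finset (V × V)} (h : S ⊆ T) (v : V) :
    excess (T \ S) v = excess T v - excess S v :=
  Finset.sum_sdiff_eq_sub h

/-- An edge leaving `X` and entering `Y` makes the submodular inequality for `X` and `Y`
strict. -/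
theorem outCut_submodular_insert {E : Finset (V × V)} {e : V × V} (he : e ∉ E)
    {X Y : Finset V} (hX : e.1 ∈ X ∧ e.2 ∉ X) (hY : e.1 ∉ Y ∧ e.2 ∈ Y) :
    outCut (insert e E) (X ∩ Y) + outCut (insert e E) (X ∪ Y) ≤ outCut E X + outCut E Y := by
  have h : outCut E (X ∩ Y) + outCut E (X ∪ Y) ≤ outCut E X + outCut E Y := by
    simp only [outCut, ← Finset.sum_add_distrib]
    refine Finset.sum_le_sum fun p _ => ?_
    by_cases p.1 ∈ X <;> by_cases p.2 ∈ X <;> by_cases p.1 ∈ Y <;> by_cases p.2 ∈ Y <;>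
      simp_all
  simpa [outCut, Finset.sum_insert he, hX, hY] using h

/-- Gale's supply-demand theorem for unit capacities. -/
theorem exists_subset_excess_eq [Fintype V] (E : Finset (V × V)) (b : V → ℤ)
    (hsum : ∑ v, b v = 0) (hb : ∀ X : Finset V, ∑ v ∈ X, b v ≤ outCut E X) :
    ∃ S ⊆ E, ∀ v, excess S v = b v := by
  induction E using Finset.induction_on generalizing b with
  | empty =>
    refine ⟨∅, le_rfl, fun v => ?_⟩
    have hle (w) (_ : w ∈ Finset.univ) : b w ≤ 0 := by simpa [outCut] using hb {w}
    simpa [excess] using ((Finset.sum_eq_zero_iff_of_nonpos hle).1 hsum v (Finset.mem_univ v)).symm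
  | insert e E he ih =>
    by_cases hdel : ∀ X : Finset V, ∑ v ∈ X, b v ≤ outCut E X
    · obtain ⟨S, hS, h⟩ := ih b hsum hdel
      exact ⟨S, hS.trans (Finset.subset_insert _ _), h⟩
    push Not at hdel
    obtain ⟨X, hX⟩ := hdel
    have hXe : e.1 ∈ X ∧ e.2 ∉ X := by
      by_contra h
      have := hb X
      rw [outCut, Finset.sum_insert he, if_neg h, zero_add] at this
      exact absurd hX (not_lt.2 this)
    set b' : V → ℤ := fun v => b v - ((if e.1 = v then 1 else 0) - if e.2 = v then 1 else 0)
      with hb'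
    have hb'sum (Y : Finset V) : ∑ v ∈ Y, b' v =
        ∑ v ∈ Y, b v - ((if e.1 ∈ Y then 1 else 0) - if e.2 ∈ Y then 1 else 0) := by
      simp [hb', Finset.sum_sub_distrib]
    obtain ⟨S, hS, h⟩ := ih b' (by simp [hb'sum, hsum]) fun Y => by
      rw [hb'sum]
      have hY := hb Y
      rw [outCut, Finset.sum_insert he, ← outCut] at hY
      by_cases h1 : e.1 ∈ Y <;> by_cases h2 : e.2 ∈ Y <;> simp only [h1, h2] at hY ⊢
      · simpa using hY
      · simp at hY ⊢; linarith
      · have hsubm := outCut_submodular_insert he hXe ⟨h1, h2⟩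
        have hi := hb (X ∩ Y)
        have hu := hb (X ∪ Y)
        have := Finset.sum_union_inter (s₁ := X) (s₂ := Y) (f := b)
        simp at hY ⊢
        linarith
      · simpa using hY
    have heS : e ∉ S := fun h' => he (hS h')
    refine ⟨insert e S, Finset.insert_subset_insert _ hS, fun v => ?_⟩
    rw [excess, Finset.sum_insert heS, ← excess, h v]
    simp [hb']

/-- If the demands `c j` sum up to the excess of `S` and on every vertex set all have the
same sign, then `S` contains disjoint edge sets meeting the individual demands. -/
theorem exists_disjoint_excess_eq [Fintype V] {ι : Type*} [DecidableEq ι] (J : Finset ι)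
    (c : ι → V → ℤ) (hc : ∀ j, ∑ v, c j v = 0)
    (hsign : ∀ X : Finset V, (∀ j, 0 ≤ ∑ v ∈ X, c j v) ∨ ∀ j, ∑ v ∈ X, c j v ≤ 0)
    (S : Finset (V × V)) (hS : ∀ v, excess S v = ∑ j ∈ J, c j v) :
    ∃ P : ι → Finset (V × V), (∀ j ∈ J, P j ⊆ S ∧ ∀ v, excess (P j) v = c j v) ∧
      ∀ i ∈ J, ∀ j ∈ J, i ≠ j → Disjoint (P i) (P j) := by
  induction J using Finset.induction_on generalizing S with
  | empty => exact ⟨fun _ => ∅, by simp, by simp⟩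
  | insert j J hj ih =>
    obtain ⟨T, hTS, hT⟩ := exists_subset_excess_eq S (c j) (hc j) fun X => by
      rcases hsign X with h | h
      · refine le_trans ?_ (sum_excess_le_outCut S X)
        simp only [hS]
        rw [Finset.sum_comm]
        exact Finset.single_le_sum (f := fun i => ∑ v ∈ X, c i v) (fun i _ => h i)
          (Finset.mem_insert_self j J)
      · exact (h j).trans (outCut_nonneg S X)
    obtain ⟨P, hP, hdisj⟩ := ih (S \ T) fun v => by
      rw [excess_sdiff hTS, hS, hT, Finset.sum_insert hj, add_sub_cancel_left]
    have hTP (i) (hi : i ∈ J) : Disjoint T (P i) :=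
      Finset.disjoint_of_subset_right (hP i hi).1 Finset.disjoint_sdiff
    refine ⟨Function.update P j T, fun i hi => ?_, fun i hi i' hi' hne => ?_⟩
    · by_cases hij : i = j
      · subst hij
        simpa using ⟨hTS, hT⟩
      · have hiJ := Finset.mem_of_mem_insert_of_ne hi hij
        simpa [hij] using ⟨(hP i hiJ).1.trans Finset.sdiff_subset, (hP i hiJ).2⟩
    · by_cases hij : i = j
      · subst hij
        simpa [hne.symm] using hTP i' (Finset.mem_of_mem_insert_of_ne hi' hne.symm)
      · have hiJ := Finset.mem_of_mem_insert_of_ne hi hij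
        by_cases hij' : i' = j
        · subst hij'
          simpa [hij] using (hTP i hiJ).symm
        · simpa [hij, hij'] using
            hdisj i hiJ i' (Finset.mem_of_mem_insert_of_ne hi' hij') hne

/-- An edge set whose only excess is a unit at `x` and whose only deficit is a unit at `y`
contains a route from `x` to `y`. -/
theorem reflTransGen_of_excess_eq [Fintype V] {P : Finset (V × V)} {x y : V}
    (h : ∀ v, excess P v = (if x = v then 1 else 0) - if y = v then 1 else 0) :
    Relation.ReflTransGen (fun u v => (u, v) ∈ P) x y := by
  classical
  by_contra hxy
  set R : Finset V :=
    Finset.univ.filter (Relation.ReflTransGen (fun u v => (u, v) ∈ P) x) with hR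
  have hle := sum_excess_le_outCut P R
  have hout : outCut P R = 0 := Finset.sum_eq_zero fun e he => if_neg <| by
    rintro ⟨h1, h2⟩
    simp only [hR, Finset.mem_filter, Finset.mem_univ, true_and] at h1 h2
    exact h2 (h1.tail he)
  have hx : x ∈ R := by simp [hR, Relation.ReflTransGen.refl]
  have hy : y ∉ R := by simpa [hR] using hxy
  simp only [h, Finset.sum_sub_distrib, Finset.sum_ite_eq, hx, hy, hout] at hle
  simp at hle

/-- The demand of one unit from `x` to `y`. -/
def unitDemand (x y v : V) : ℤ := (if x = v then 1 else 0) - if y = v then 1 else 0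

theorem sum_unitDemand (x y : V) (X : Finset V) :
    ∑ v ∈ X, unitDemand x y v = (if x ∈ X then 1 else 0) - if y ∈ X then 1 else 0 := by
  simp [unitDemand, Finset.sum_sub_distrib]

/-- If every vertex set separating two of the `t` terminals `φ i` has at least `t (t - 1)`
leaving edges, then an Eulerian digraph contains an immersion of `K⃗ₜ` on these terminals:
all paths are routed through a common terminal. -/
theorem diImmersionVia_bidirComplete [Fintype V] {A : V → V → Prop} {E : Finset (V × V)}
    (hA : ∀ e ∈ E, A e.1 e.2) (hE : ∀ v, excess E v = 0) {t : ℕ} (ht : 1 ≤ t)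
    {φ : Fin t → V} (hφ : Function.Injective φ)
    (hcut : ∀ X : Finset V, (∃ i, φ i ∈ X) → (∃ i, φ i ∉ X) → (t * (t - 1) : ℤ) ≤ outCut E X) :
    DiImmersionVia (bidirComplete t) A φ := by
  set r : V := φ ⟨0, ht⟩ with hr
  set J : Finset (Fin t × Fin t) := Finset.univ.offDiag with hJ
  have hJcard : (J.card : ℤ) = t * (t - 1) := by
    rw [hJ, Finset.offDiag_card, Nat.cast_sub (Nat.le_mul_self _)]
    simp
    ring
  have hswap (v) : ∑ p ∈ J, unitDemand r (φ p.2) v = - ∑ p ∈ J, unitDemand (φ p.1) r v := by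
    rw [← Finset.sum_neg_distrib]
    refine Finset.sum_equiv (Equiv.prodComm _ _) (fun p => ?_) fun p _ => ?_
    · simp [hJ, ne_comm]
    · change unitDemand r (φ p.2) v = -unitDemand (φ p.2) r v
      simp [unitDemand]
  obtain ⟨S, hSE, hS⟩ := exists_subset_excess_eq E (fun v => ∑ p ∈ J, unitDemand (φ p.1) r v)
    (by rw [Finset.sum_comm]; simp [sum_unitDemand]) fun X => by
      rw [Finset.sum_comm]
      simp only [sum_unitDemand]
      by_cases hrX : r ∈ X
      · refine (Finset.sum_nonpos fun p _ => ?_).trans (outCut_nonneg E X)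
        simp only [hrX, if_true]
        split_ifs <;> simp
      · by_cases h : ∃ i, φ i ∈ X
        · refine le_trans ?_ (hcut X h ⟨_, hrX⟩)
          rw [← hJcard, Finset.card_eq_sum_ones, Nat.cast_sum]
          refine Finset.sum_le_sum fun p _ => ?_
          simp only [hrX, if_false]
          split_ifs <;> simp
        · push Not at h
          simpa [h, hrX] using outCut_nonneg E X
  obtain ⟨P, hP, hPd⟩ := exists_disjoint_excess_eq J (fun p => unitDemand (φ p.1) r)
    (by simp [sum_unitDemand])
    (fun X => by
      simp only [sum_unitDemand]
      by_cases hrX : r ∈ X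
      · right; intro p; simp only [hrX, if_true]; split_ifs <;> simp
      · left; intro p; simp only [hrX, if_false]; split_ifs <;> simp)
    S hS
  obtain ⟨Q, hQ, hQd⟩ := exists_disjoint_excess_eq J (fun p => unitDemand r (φ p.2))
    (by simp [sum_unitDemand])
    (fun X => by
      simp only [sum_unitDemand]
      by_cases hrX : r ∈ X
      · left; intro p; simp only [hrX, if_true]; split_ifs <;> simp
      · right; intro p; simp only [hrX, if_false]; split_ifs <;> simp)
    (E \ S) fun v => by rw [excess_sdiff hSE, hE, hS, hswap, zero_sub]
  have hPQ (p) (hp : p ∈ J) (q) (hq : q ∈ J) : Disjoint (P p) (Q q) :=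
    Finset.disjoint_of_subset_left (hP p hp).1
      (Finset.disjoint_of_subset_right (hQ q hq).1 Finset.disjoint_sdiff)
  have hpath (a b : Fin t) (hab : bidirComplete t a b) :
      ∃ l, IsDiPath (fun u v => (u, v) ∈ P (a, b) ∪ Q (a, b)) (φ a) (φ b) l := by
    have hp : (a, b) ∈ J := by simpa [hJ, bidirComplete] using hab
    refine exists_isDiPath_of_reflTransGen (reflTransGen_of_excess_eq fun v => ?_)
    rw [excess_union (hPQ _ hp _ hp), (hP _ hp).2, (hQ _ hp).2]
    simp [unitDemand]
  choose l hl using hpath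
  refine ⟨hφ, l, fun a b hab => ?_, fun a b a' b' hab hab' hne e he he' => ?_⟩
  · have hp : (a, b) ∈ J := by simpa [hJ, bidirComplete] using hab
    refine ⟨List.IsChain.imp (fun u v huv => ?_) (hl a b hab).1, (hl a b hab).2⟩
    refine hA (u, v) ?_
    rcases Finset.mem_union.1 huv with h | h
    · exact hSE ((hP _ hp).1 h)
    · exact Finset.sdiff_subset ((hQ _ hp).1 h)
  · have hp : (a, b) ∈ J := by simpa [hJ, bidirComplete] using hab
    have hp' : (a', b') ∈ J := by simpa [hJ, bidirComplete] using hab'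
    have h1 := rel_of_mem_diWalkEdges (hl a b hab).1 he
    have h2 := rel_of_mem_diWalkEdges (hl a' b' hab').1 he'
    refine Finset.disjoint_left.1 ?_ h1 h2
    simp only [Finset.disjoint_union_left, Finset.disjoint_union_right]
    exact ⟨⟨hPd _ hp _ hp' hne, (hPQ _ hp' _ hp).symm⟩, hPQ _ hp _ hp', hQd _ hp _ hp' hne⟩

open Classical in
theorem excess_eq_zero_of_isEulerianDigraph [Fintype V] {A : V → V → Prop}
    (h : IsEulerianDigraph A) (v : V) :
    excess (Finset.univ.filter fun p : V × V => A p.1 p.2) v = 0 := by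
  have hv := h.2 v
  rw [diInDeg, diOutDeg, Set.ncard_eq_toFinset_card', Set.ncard_eq_toFinset_card'] at hv
  simp only [Set.toFinset_ofPred, Finset.card_filter] at hv
  rw [excess, Finset.sum_sub_distrib, sub_eq_zero, Finset.sum_filter, Finset.sum_filter,
    Fintype.sum_prod_type, Fintype.sum_prod_type_right]
  refine (Finset.sum_eq_single v ?_ (by simp)).trans
    (Eq.trans ?_ (Finset.sum_eq_single v ?_ (by simp)).symm)
  · intro w _ hw; simp [hw]
  · simpa using (congrArg (Nat.cast (R := ℤ)) hv).symm
  · intro w _ hw; simp [hw]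

open Classical in
theorem cutWeight_eq_two_mul_outCut [Fintype V] {A : V → V → Prop}
    (h : IsEulerianDigraph A) (X : Finset V) :
    (cutWeight (fun p => if A p.1 p.2 then 1 else 0) (X : Set V) : ℤ) =
      2 * outCut (Finset.univ.filter fun p : V × V => A p.1 p.2) X := by
  have h0 := sum_excess (Finset.univ.filter fun p : V × V => A p.1 p.2) X
  simp only [excess_eq_zero_of_isEulerianDigraph h, Finset.sum_const_zero] at h0
  suffices (cutWeight (fun p => if A p.1 p.2 then 1 else 0) (X : Set V) : ℤ) +
      ∑ e ∈ Finset.univ.filter (fun p : V × V => A p.1 p.2),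
        ((if e.1 ∈ X then 1 else 0) - if e.2 ∈ X then 1 else 0) =
      2 * outCut (Finset.univ.filter fun p : V × V => A p.1 p.2) X by
    rw [← this, ← h0, add_zero]
  rw [cutWeight, outCut, Finset.mul_sum, Finset.sum_filter, Finset.sum_filter, Nat.cast_sum,
    ← Finset.sum_add_distrib]
  clear h0
  refine Finset.sum_congr rfl fun p _ => ?_
  by_cases A p.1 p.2 <;> by_cases p.1 ∈ X <;> by_cases p.2 ∈ X <;> simp_all

end Flow

/-- Every finite simple Eulerian digraph with no `K⃗_t`-immersion admits
a laminar family of edge-cuts of size `< 2t(t-1)` whose induced vertex partition has all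
blocks of size `< t`. -/
theorem stmt_1 {V : Type*} [Fintype V] (t : ℕ) (ht : 1 ≤ t) (A : V → V → Prop)
    (hEul : IsEulerianDigraph A)
    (hD : ¬ DiImmersion (bidirComplete t) A) :
    ∃ F : Set (Set V), IsLaminar F ∧
      (∀ X ∈ F, (diCutEdges A X).ncard < 2 * t * (t - 1)) ∧
      (∀ v : V, (laminarBlock F v).ncard < t) := by
  classical
  obtain ⟨F, hF, hFcut, hsep⟩ :=
    exists_laminar_separating (fun p : V × V => if A p.1 p.2 then 1 else 0) (2 * t * (t - 1))
  simp only [← ncard_diCutEdges_eq_cutWeight] at hFcut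
  refine ⟨F, hF, hFcut, fun v => ?_⟩
  by_contra! hcard
  obtain ⟨T, hTB, hT⟩ := Set.exists_subset_card_eq hcard
  have e : T ≃ Fin t := Finite.equivFinOfCardEq hT
  refine hD ⟨fun i => e.symm i, diImmersionVia_bidirComplete (by simp)
    (excess_eq_zero_of_isEulerianDigraph hEul) ht
    (Subtype.val_injective.comp e.symm.injective) ?_⟩
  rintro X ⟨i, hi⟩ ⟨j, hj⟩
  have hle : 2 * t * (t - 1) ≤ cutWeight (fun p => if A p.1 p.2 then 1 else 0) (X : Set V) := by
    by_contra! hlt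
    have h1 := hsep _ v (hTB (e.symm i).2) _ hlt
    have h2 := hsep _ v (hTB (e.symm j).2) _ hlt
    exact hj (h2.2 (h1.1 hi))
  have hle' := cutWeight_eq_two_mul_outCut hEul X
  zify [ht] at hle
  linarith
end

section
/- Let t ≥ 2 be an integer, let G be a finite simple graph, and let v_1, v_2, …, v_t be distinct vertices of G. Suppose that every edge-cut δ(X) of G that separates some pair of these vertices (i.e. with v_i ∈ X and v_j ∉ X for some i, j) has at least (t-1)^2 edges. Then G contains an immersion of the complete graph K_t. -/
namespace SimpleGraph

open Finset

variable {V : Type*} {G : SimpleGraph V}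

/-- An integral flow on `G` in which every edge has capacity one, recorded as a skew-symmetric
function: `f u v` is the amount sent from `u` to `v`. -/
structure IsUnitFlow (G : SimpleGraph V) (f : V → V → ℤ) : Prop where
  skew : ∀ u v, f u v = -f v u
  le_one : ∀ u v, f u v ≤ 1
  adj : ∀ u v, f u v ≠ 0 → G.Adj u v

/-- The net amount of flow absorbed at `v`. -/
def inflow [Fintype V] (f : V → V → ℤ) (v : V) : ℤ := ∑ u, f u v

open Classical in
/-- The flow that sends one unit along each step of a walk. -/
noncomputable def Walk.unitFlow : ∀ {a b : V}, G.Walk a b → V → V → ℤ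
  | _, _, .nil => 0
  | a, _, .cons (v := c) _ p => fun u w =>
      (if u = a ∧ w = c then 1 else 0) - (if u = c ∧ w = a then 1 else 0) + p.unitFlow u w

lemma Walk.unitFlow_skew {a b : V} (p : G.Walk a b) (u w : V) :
    p.unitFlow u w = -p.unitFlow w u := by
  induction p with
  | nil => simp [Walk.unitFlow]
  | @cons a c _ h p ih =>
    simp only [Walk.unitFlow, ih, ite_and]
    split_ifs <;> ring

open Classical in
lemma Walk.inflow_unitFlow [Fintype V] {a b : V} (p : G.Walk a b) (v : V) :
    inflow p.unitFlow v = (if v = b then 1 else 0) - (if v = a then 1 else 0) := by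
  induction p with
  | nil => simp [Walk.unitFlow, inflow]
  | cons h p ih =>
    simp only [inflow] at ih
    simp only [inflow, Walk.unitFlow, sum_add_distrib, sum_sub_distrib, ih, ite_and, sum_ite_eq',
      mem_univ, if_true]
    simp

lemma Walk.unitFlow_eq_zero {a b : V} (p : G.Walk a b) {u w : V} (h : s(u, w) ∉ p.edges) :
    p.unitFlow u w = 0 := by
  induction p with
  | nil => simp [Walk.unitFlow]
  | cons hadj p ih =>
    simp only [Walk.edges_cons, List.mem_cons, not_or, Sym2.eq_iff] at h
    simp [Walk.unitFlow, ih h.2, h.1.1, h.1.2]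

lemma Walk.IsTrail.unitFlow_eq_one {a b : V} {p : G.Walk a b} (hp : p.IsTrail) {d : G.Dart}
    (hd : d ∈ p.darts) : p.unitFlow d.fst d.snd = 1 := by
  induction p with
  | nil => simp at hd
  | @cons a c b hadj p ih =>
    rw [Walk.isTrail_cons] at hp
    rw [Walk.darts_cons, List.mem_cons] at hd
    rcases hd with rfl | hd
    · simp [Walk.unitFlow, p.unitFlow_eq_zero hp.2, hadj.ne]
    · have hmem : s(d.fst, d.snd) ∈ p.edges := List.mem_map_of_mem hd
      have h₁ : ¬ (d.fst = a ∧ d.snd = c) := by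
        rintro ⟨h, h'⟩
        exact hp.2 (by rwa [h, h'] at hmem)
      have h₂ : ¬ (d.fst = c ∧ d.snd = a) := by
        rintro ⟨h, h'⟩
        exact hp.2 (by rwa [h, h', Sym2.eq_swap] at hmem)
      simp [Walk.unitFlow, ih hp.1 hd, h₁, h₂]

lemma Walk.exists_dart_of_mem_edges {a b : V} {p : G.Walk a b} {u w : V}
    (h : s(u, w) ∈ p.edges) :
    ∃ d ∈ p.darts, d.fst = u ∧ d.snd = w ∨ d.fst = w ∧ d.snd = u := by
  obtain ⟨d, hd, he⟩ := List.mem_map.1 h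
  exact ⟨d, hd, Sym2.eq_iff.1 he⟩

lemma Walk.IsTrail.unitFlow_cases {a b : V} {p : G.Walk a b} (hp : p.IsTrail) (u w : V) :
    s(u, w) ∉ p.edges ∧ p.unitFlow u w = 0 ∨
      (∃ d ∈ p.darts, d.fst = u ∧ d.snd = w) ∧ p.unitFlow u w = 1 ∨
      (∃ d ∈ p.darts, d.fst = w ∧ d.snd = u) ∧ p.unitFlow u w = -1 := by
  by_cases h : s(u, w) ∈ p.edges
  · obtain ⟨d, hd, ⟨rfl, rfl⟩ | ⟨rfl, rfl⟩⟩ := Walk.exists_dart_of_mem_edges h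
    · exact .inr (.inl ⟨⟨d, hd, rfl, rfl⟩, hp.unitFlow_eq_one hd⟩)
    · refine .inr (.inr ⟨⟨d, hd, rfl, rfl⟩, ?_⟩)
      rw [p.unitFlow_skew, hp.unitFlow_eq_one hd]
  · exact .inl ⟨h, p.unitFlow_eq_zero h⟩

lemma IsUnitFlow.add_unitFlow {f : V → V → ℤ} (hf : G.IsUnitFlow f) {a b : V} {p : G.Walk a b}
    (hp : p.IsTrail) (hres : ∀ d ∈ p.darts, f d.fst d.snd ≤ 0) :
    G.IsUnitFlow (f + p.unitFlow) where
  skew u v := by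
    simp only [Pi.add_apply, hf.skew u v, p.unitFlow_skew u v]
    ring
  le_one u v := by
    have := hf.le_one u v
    simp only [Pi.add_apply]
    rcases hp.unitFlow_cases u v with ⟨-, h⟩ | ⟨⟨d, hd, rfl, rfl⟩, h⟩ | ⟨-, h⟩
    · lia
    · have := hres d hd
      lia
    · lia
  adj u v h := by
    simp only [Pi.add_apply] at h
    rcases hp.unitFlow_cases u v with ⟨-, h'⟩ | ⟨⟨d, -, rfl, rfl⟩, -⟩ | ⟨⟨d, -, rfl, rfl⟩, -⟩
    · exact hf.adj u v (by simpa [h'] using h)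
    · exact d.adj
    · exact d.adj.symm

lemma IsUnitFlow.sub_unitFlow {f : V → V → ℤ} (hf : G.IsUnitFlow f) {a b : V} {p : G.Walk a b}
    (hp : p.IsTrail) (hpos : ∀ d ∈ p.darts, f d.fst d.snd = 1) :
    G.IsUnitFlow (f - p.unitFlow) ∧
      ∀ u v, (f - p.unitFlow) u v ≠ 0 → f u v ≠ 0 ∧ s(u, v) ∉ p.edges := by
  have key : ∀ u v, (f - p.unitFlow) u v = 0 ∨
      (f - p.unitFlow) u v = f u v ∧ s(u, v) ∉ p.edges := by
    intro u v
    simp only [Pi.sub_apply]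
    rcases hp.unitFlow_cases u v with ⟨he, h⟩ | ⟨⟨d, hd, rfl, rfl⟩, h⟩ | ⟨⟨d, hd, rfl, rfl⟩, h⟩
    · exact .inr ⟨by lia, he⟩
    · exact .inl (by rw [h, hpos d hd, sub_self])
    · exact .inl (by rw [h, hf.skew, hpos d hd, sub_self])
  refine ⟨⟨fun u v => ?_, fun u v => ?_, fun u v h => ?_⟩, fun u v h => ?_⟩
  · simp only [Pi.sub_apply, hf.skew u v, p.unitFlow_skew u v]
    ring
  · have := hf.le_one u v
    rcases key u v with h | h <;> lia
  · rcases key u v with h' | h'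
    · exact absurd h' h
    · exact hf.adj u v (h'.1 ▸ h)
  · rcases key u v with h' | h'
    · exact absurd h' h
    · exact ⟨h'.1 ▸ h, h'.2⟩

/-- There is a path from `a` to `b` with all steps satisfying `R`, unless some vertex set containing
`a` but not `b` is left by no such step. -/
lemma exists_path_or_closed (R : V → V → Prop) (a b : V) :
    (∃ p : G.Walk a b, p.IsPath ∧ ∀ d ∈ p.darts, R d.fst d.snd) ∨
      ∃ X : Set V, a ∈ X ∧ b ∉ X ∧ ∀ u ∈ X, ∀ w ∉ X, G.Adj u w → ¬ R u w := by
  classical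
  by_cases h : ∃ p : G.Walk a b, ∀ d ∈ p.darts, R d.fst d.snd
  · obtain ⟨p, hp⟩ := h
    exact .inl ⟨p.bypass, p.bypass_isPath, fun d hd => hp d (p.darts_bypass_subset_darts hd)⟩
  · refine .inr ⟨{c | ∃ p : G.Walk a c, ∀ d ∈ p.darts, R d.fst d.snd}, ⟨.nil, by simp⟩, h, ?_⟩
    rintro u ⟨p, hp⟩ w hw huw hR
    refine hw ⟨p.concat huw, fun d hd => ?_⟩
    rw [Walk.darts_concat, List.concat_eq_append, List.mem_append, List.mem_singleton] at hd
    rcases hd with hd | rfl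
    · exact hp d hd
    · exact hR

variable {ι : Type*}

open Classical in
lemma sum_card_filter_eq (s : Finset ι) (τ : ι → V) (Y : Finset V) :
    ∑ v ∈ Y, (#{i ∈ s | τ i = v} : ℤ) = #{i ∈ s | τ i ∈ Y} := by
  rw [card_eq_sum_card_fiberwise (f := τ) (t := Y) (fun i hi => by simpa using (mem_filter.1 hi).2)]
  push_cast
  refine sum_congr rfl fun v hv => ?_
  congr 2
  ext i
  simp only [mem_filter]
  grind

variable [Fintype V]

lemma inflow_add (f g : V → V → ℤ) (v : V) : inflow (f + g) v = inflow f v + inflow g v := by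
  simp [inflow, sum_add_distrib]

lemma inflow_sub (f g : V → V → ℤ) (v : V) : inflow (f - g) v = inflow f v - inflow g v := by
  simp [inflow, sum_sub_distrib]

open Classical in
lemma IsUnitFlow.sum_inflow {f : V → V → ℤ} (hf : G.IsUnitFlow f) (Y : Finset V) :
    ∑ v ∈ Y, inflow f v = ∑ v ∈ Y, ∑ u ∈ Yᶜ, f u v := by
  have hzero : ∑ v ∈ Y, ∑ u ∈ Y, f u v = 0 := by
    have : ∑ v ∈ Y, ∑ u ∈ Y, f u v = -∑ v ∈ Y, ∑ u ∈ Y, f u v := by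
      conv_lhs => rw [sum_comm]
      simp only [← sum_neg_distrib]
      exact sum_congr rfl fun u _ => sum_congr rfl fun v _ => hf.skew u v
    lia
  simp only [inflow, ← sum_add_sum_compl Y, sum_add_distrib, hzero, zero_add]

open Classical in
lemma IsUnitFlow.ncard_cutEdges_le {f : V → V → ℤ} (hf : G.IsUnitFlow f) (X : Set V)
    (hfull : ∀ u ∈ X, ∀ w ∉ X, G.Adj u w → ¬ f u w ≤ 0) :
    ((G.cutEdges X).ncard : ℤ) ≤ ∑ v with v ∉ X, inflow f v := by
  set Y : Finset V := {v | v ∉ X} with hY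
  have hsub : G.cutEdges X ⊆
      ((Y ×ˢ Yᶜ).filter fun q => G.Adj q.2 q.1).image fun q => s(q.2, q.1) := by
    rintro e ⟨he, a, b, rfl, ha, hb⟩
    simp only [coe_image, Set.mem_image, mem_coe, mem_filter, mem_product]
    exact ⟨(b, a), ⟨⟨by simpa [hY] using hb, by simpa [hY] using ha⟩, he⟩, rfl⟩
  have hcard := (Set.ncard_le_ncard hsub (Finset.finite_toSet _)).trans
    ((Set.ncard_coe_finset _).trans_le card_image_le)
  rw [hf.sum_inflow, ← sum_product' (f := fun v u => f u v)]
  refine (Int.ofNat_le.2 hcard).trans ?_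
  rw [card_filter]
  push_cast
  refine sum_le_sum fun q hq => ?_
  simp only [mem_product, hY, mem_compl, mem_filter, mem_univ, true_and, not_not] at hq
  split_ifs with hadj
  · have := hfull _ hq.2 _ hq.1 hadj
    lia
  · have : f q.2 q.1 = 0 := by
      by_contra h
      exact hadj (hf.adj _ _ h)
    lia

open Classical in
/-- Integral max-flow min-cut, for one source `r` and a sink `τ i` of demand one for each
`i ∈ s`. -/
lemma exists_isUnitFlow (r : V) (s : Finset ι) (τ : ι → V) (hτ : ∀ i ∈ s, τ i ≠ r)
    (hcut : ∀ X : Set V, r ∈ X → #{i ∈ s | τ i ∉ X} ≤ (G.cutEdges X).ncard) :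
    ∃ f, G.IsUnitFlow f ∧ ∀ v ≠ r, inflow f v = #{i ∈ s | τ i = v} := by
  induction s using Finset.induction_on with
  | empty => exact ⟨0, ⟨by simp, by simp, by simp⟩, by simp [inflow]⟩
  | insert i s hi ih =>
    obtain ⟨f, hf, hnet⟩ := ih (fun j hj => hτ j (mem_insert_of_mem hj)) fun X hX =>
      (card_le_card (filter_subset_filter _ (subset_insert i s))).trans (hcut X hX)
    rcases exists_path_or_closed (G := G) (fun u w => f u w ≤ 0) r (τ i) with
      ⟨p, hp, hres⟩ | ⟨X, hr, hiX, hfull⟩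
    · refine ⟨_, hf.add_unitFlow hp.isTrail hres, fun v hv => ?_⟩
      rw [inflow_add, hnet v hv, p.inflow_unitFlow, filter_insert, if_neg hv]
      by_cases h : v = τ i
      · simp [h, hi]
      · simp [h, Ne.symm h]
    · exfalso
      have h₁ := hf.ncard_cutEdges_le X hfull
      have h₂ : ∑ v with v ∉ X, inflow f v = #{j ∈ s | τ j ∉ X} := by
        rw [sum_congr rfl fun v hv => hnet v ?_, sum_card_filter_eq]
        · simp
        · rintro rfl
          simp [hr] at hv
      have h₃ := hcut X hr
      rw [filter_insert, if_pos hiX, card_insert_of_notMem (by simp [hi])] at h₃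
      lia

open Classical in
/-- Decomposition of a unit flow into edge-disjoint walks from the source to the sinks. -/
lemma IsUnitFlow.exists_disjoint_walks (r : V) (s : Finset ι) (τ : ι → V)
    (hτ : ∀ i ∈ s, τ i ≠ r) {f : V → V → ℤ} (hf : G.IsUnitFlow f)
    (hnet : ∀ v ≠ r, inflow f v = #{i ∈ s | τ i = v}) :
    ∃ E : ι → Set (Sym2 V), (s : Set ι).PairwiseDisjoint E ∧
      (∀ i ∈ s, ∀ u v, s(u, v) ∈ E i → f u v ≠ 0) ∧
      ∀ i ∈ s, ∃ p : G.Walk r (τ i), ∀ e ∈ p.edges, e ∈ E i := by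
  induction s using Finset.induction_on generalizing f with
  | empty => exact ⟨fun _ => ∅, by simp, by simp, by simp⟩
  | insert i s hi ih =>
    rcases exists_path_or_closed (G := G) (fun u w => f u w = 1) r (τ i) with
      ⟨p, hp, hpos⟩ | ⟨X, hr, hiX, hclosed⟩
    · obtain ⟨hf', hsub⟩ := hf.sub_unitFlow hp.isTrail hpos
      obtain ⟨E, hE, hEf, hEp⟩ := ih (fun j hj => hτ j (mem_insert_of_mem hj)) hf' fun v hv => by
        rw [inflow_sub, hnet v hv, p.inflow_unitFlow, filter_insert, if_neg hv]
        by_cases h : v = τ i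
        · simp [h, hi]
        · simp [h, Ne.symm h]
      have hne : ∀ j ∈ s, j ≠ i := fun j hj h => hi (h ▸ hj)
      refine ⟨Function.update E i {e | e ∈ p.edges}, ?_, ?_, ?_⟩
      · rw [coe_insert, Set.pairwiseDisjoint_insert_of_notMem (by simpa using hi)]
        refine ⟨fun j hj k hk hjk => ?_, fun j hj => ?_⟩
        · simpa [Function.onFun, hne j hj, hne k hk] using hE hj hk hjk
        · rw [Function.update_self, Function.update_of_ne (hne j hj), Set.disjoint_left]
          rintro ⟨u, v⟩ he he'
          exact (hsub u v (hEf j hj u v he')).2 he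
      · intro j hj u v he
        rcases mem_insert.1 hj with rfl | hj
        · rw [Function.update_self] at he
          obtain ⟨d, hd, ⟨rfl, rfl⟩ | ⟨rfl, rfl⟩⟩ := Walk.exists_dart_of_mem_edges he
          · simp [hpos d hd]
          · rw [hf.skew]
            simp [hpos d hd]
        · rw [Function.update_of_ne (hne j hj)] at he
          exact (hsub u v (hEf j hj u v he)).1
      · intro j hj
        rcases mem_insert.1 hj with rfl | hj
        · exact ⟨p, by simp⟩
        · rw [Function.update_of_ne (hne j hj)]
          exact hEp j hj
    · exfalso
      have h₁ : ∑ v with v ∉ X, inflow f v ≤ 0 := by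
        rw [hf.sum_inflow]
        refine sum_nonpos fun v hv => sum_nonpos fun u hu => ?_
        simp only [mem_compl, mem_filter, mem_univ, true_and, not_not] at hu hv
        by_contra! h
        have := hf.le_one u v
        exact hclosed u hu v hv (hf.adj u v h.ne') (by lia)
      rw [sum_congr rfl fun v hv => hnet v ?_, sum_card_filter_eq] at h₁
      · have : 0 < #{j ∈ insert i s | τ j ∈ ({v | v ∉ X} : Finset V)} :=
          card_pos.2 ⟨i, by simp [hiX]⟩
        lia
      · rintro rfl
        simp [hr] at hv

end SimpleGraph

/-- If every edge-cut separating a pair of the `t` distinct vertices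
`v 0, …, v (t-1)` has at least `(t-1)^2` edges, then `G` immerses `K_t`. -/
theorem stmt_2 {V : Type*} [Fintype V] (t : ℕ) (ht : 2 ≤ t) (G : SimpleGraph V)
    (v : Fin t → V) (hv : Function.Injective v)
    (hcut : ∀ X : Set V, (∃ i j : Fin t, v i ∈ X ∧ v j ∉ X) →
      (t - 1) ^ 2 ≤ (G.cutEdges X).ncard) :
    SimpleGraph.Immersion (⊤ : SimpleGraph (Fin t)) G := by
  classical
  let z : Fin t := ⟨0, by lia⟩
  let s : Finset (Σ _ : Fin t, Fin t) :=
    (Finset.univ.erase z).sigma fun a => Finset.univ.erase a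
  have hs : s.card = (t - 1) ^ 2 := by
    simp [s, Finset.card_sigma, Finset.card_erase_of_mem, sq]
  have hsτ : ∀ q ∈ s, v q.1 ≠ v z := fun q hq =>
    hv.ne (Finset.ne_of_mem_erase (Finset.mem_sigma.1 hq).1)
  obtain ⟨f, hf, hnet⟩ := SimpleGraph.exists_isUnitFlow (G := G) (v z) s (fun q => v q.1) hsτ
    fun X hX => by
      rcases (s.filter fun q => v q.1 ∉ X).eq_empty_or_nonempty with h | ⟨q, hq⟩
      · simp [h]
      · exact (Finset.card_filter_le _ _).trans
          (hs.trans_le (hcut X ⟨z, q.1, hX, (Finset.mem_filter.1 hq).2⟩))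
  obtain ⟨E, hE, -, hEp⟩ := hf.exists_disjoint_walks (v z) s (fun q => v q.1) hsτ hnet
  have hmem : ∀ a b : Fin t, a ≠ z → a ≠ b → (⟨a, b⟩ : Σ _ : Fin t, Fin t) ∈ s := by
    intro a b ha hab
    simp [s, ha, hab.symm]
  have hwalk : ∀ a b : Fin t, ∃ p : G.Walk (v z) (v a), a ≠ b →
      ∀ e ∈ p.edges, a ≠ z ∧ e ∈ E ⟨a, b⟩ := by
    intro a b
    by_cases ha : a = z
    · subst ha
      exact ⟨.nil, by simp⟩
    · by_cases hab : a = b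
      · obtain ⟨p, -⟩ := hEp ⟨a, z⟩ (hmem a z ha ha)
        exact ⟨p, fun h => absurd hab h⟩
      · obtain ⟨p, hp⟩ := hEp ⟨a, b⟩ (hmem a b ha hab)
        exact ⟨p, fun _ e he => ⟨ha, hp e he⟩⟩
  choose W hW using hwalk
  have hdisj : ∀ {a b a' b' : Fin t}, a ≠ b → a' ≠ b' → ∀ {e}, e ∈ (W a b).edges →
      e ∈ (W a' b').edges → a = a' ∧ b = b' := by
    intro a b a' b' hab hab' e he he'
    obtain ⟨ha, he⟩ := hW a b hab e he
    obtain ⟨ha', he'⟩ := hW a' b' hab' e he'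
    by_contra h
    refine Set.disjoint_left.1 (hE (hmem a b ha hab) (hmem a' b' ha' hab') ?_) he he'
    simpa using h
  have hsplit : ∀ {a b : Fin t} {e}, e ∈ ((W a b).reverse.append (W b a)).bypass.edges →
      e ∈ (W a b).edges ∨ e ∈ (W b a).edges := by
    intro a b e he
    simpa using SimpleGraph.Walk.edges_bypass_subset_edges _ he
  refine ⟨v, hv, fun a b _ => ((W a b).reverse.append (W b a)).bypass,
    fun a b _ => SimpleGraph.Walk.bypass_isPath _, ?_⟩
  intro a b a' b' h h' hne e he he'
  rw [SimpleGraph.top_adj] at h h'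
  apply hne
  rw [Sym2.eq_iff]
  rcases hsplit he with he | he <;> rcases hsplit he' with he' | he'
  · exact .inl (hdisj h h' he he')
  · exact .inr (hdisj h h'.symm he he')
  · exact .inr (hdisj h.symm h' he he').symm
  · exact .inl (hdisj h.symm h'.symm he he').symm
end

section
/- Let t ≥ 2 be an integer, let G be a finite simple graph, and let v_1, v_2, …, v_t be distinct vertices of G. Suppose there is a family of (t-1)^2 pairwise edge-disjoint paths in G, each starting at v_1, such that for each j with 2 ≤ j ≤ t exactly t-1 of the paths end at v_j. Then G contains an immersion of the complete graph K_t (with the t branch vertices mapped to v_1, …, v_t). -/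
theorem exists_mapsTo_injOn_of_ncard_le {α β : Type*} [Finite α] [Finite β] [Nonempty β]
    {s : Set α} {s' : Set β} (h : s.ncard ≤ s'.ncard) :
    ∃ f : α → β, Set.MapsTo f s s' ∧ Set.InjOn f s := by
  obtain ⟨f, hf, hinj⟩ := s.toFinite.exists_injOn_of_encard_le (t := s') (by
    rw [← s.toFinite.cast_ncard_eq, ← s'.toFinite.cast_ncard_eq]
    exact_mod_cast h)
  exact ⟨f, hf, hinj⟩

/-- If `t - 1` pairwise edge-disjoint walks lead from `v z` to each other `v j`, then `G` immerses
`K_t` on the `v j`: the branch path from `v a` to `v b` runs through `v z`. -/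
theorem immersionVia_top_of_edgeDisjoint_walks {V ι : Type*} [Finite ι] [Nonempty ι] {t : ℕ}
    {G : SimpleGraph V} {v : Fin t → V} (hv : Function.Injective v) (z : Fin t) {ep : ι → V}
    (P : ∀ i, G.Walk (v z) (ep i))
    (hdisj : ∀ i j, i ≠ j → ∀ e ∈ (P i).edges, e ∉ (P j).edges)
    (hend : ∀ j : Fin t, j ≠ z → {i | ep i = v j}.ncard = t - 1) :
    SimpleGraph.ImmersionVia (⊤ : SimpleGraph (Fin t)) G v := by
  classical
  have hsel : ∀ a : Fin t, ∃ f : Fin t → ι,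
      a ≠ z → (∀ b, b ≠ a → ep (f b) = v a) ∧ ∀ b c, b ≠ a → c ≠ a → f b = f c → b = c := by
    intro a
    by_cases ha : a = z
    · exact ⟨fun _ => Classical.arbitrary ι, fun h => absurd ha h⟩
    obtain ⟨f, hmaps, hinj⟩ := exists_mapsTo_injOn_of_ncard_le
      (s := {b : Fin t | b ≠ a}) (s' := {i | ep i = v a}) (by
        rw [hend a ha, Set.ncard_eq_toFinset_card']
        simp [Finset.filter_ne'])
    exact ⟨f, fun _ => ⟨fun b hb => hmaps hb, fun b c hb hc h => hinj hb hc h⟩⟩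
  choose f hf using hsel
  have hleg : ∀ a b : Fin t, a ≠ b → ∃ q : G.Walk (v z) (v a),
      ∀ e ∈ q.edges, a ≠ z ∧ e ∈ (P (f a b)).edges := by
    intro a b hab
    by_cases ha : a = z
    · subst ha
      exact ⟨.nil, by simp⟩
    · exact ⟨(P (f a b)).copy rfl ((hf a ha).1 b hab.symm), by simp [ha]⟩
  choose q hq using hleg
  have hq_disj : ∀ a b a' b' (h : a ≠ b) (h' : a' ≠ b'), (a, b) ≠ (a', b') →
      ∀ e ∈ (q a b h).edges, e ∉ (q a' b' h').edges := by
    intro a b a' b' h h' hne e he he'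
    obtain ⟨ha, he⟩ := hq a b h e he
    obtain ⟨ha', he'⟩ := hq a' b' h' e he'
    refine hdisj (f a b) (f a' b') (fun hff => hne ?_) e he he'
    have haa : a = a' := hv (by
      rw [← (hf a ha).1 b h.symm, hff, (hf a' ha').1 b' h'.symm])
    subst haa
    rw [(hf a ha).2 b b' h.symm h'.symm hff]
  refine ⟨hv, fun a b h => ((q a b h.ne).reverse.append (q b a h.ne')).bypass,
    fun a b h => SimpleGraph.Walk.bypass_isPath _, ?_⟩
  intro a b a' b' h h' hne e he he'
  have hmem : ∀ {c d : Fin t} (k : (⊤ : SimpleGraph (Fin t)).Adj c d),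
      e ∈ ((q c d k.ne).reverse.append (q d c k.ne')).bypass.edges →
      e ∈ (q c d k.ne).edges ∨ e ∈ (q d c k.ne').edges := by
    intro c d k hk
    simpa using SimpleGraph.Walk.edges_bypass_subset_edges _ hk
  have hne' : ¬ ((a = a' ∧ b = b') ∨ (a = b' ∧ b = a')) := by simpa using hne
  rcases hmem h he with h₁ | h₁ <;> rcases hmem h' he' with h₂ | h₂ <;>
    refine hq_disj _ _ _ _ _ _ ?_ e h₁ h₂ <;> simp only [ne_eq, Prod.mk.injEq] <;> tauto

/-- Given `(t-1)^2` pairwise edge-disjoint paths starting at `v 0`, with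
exactly `t-1` of them ending at each `v j` for `j ≠ 0`, the graph `G` immerses `K_t` with
branch vertices `v 0, …, v (t-1)`. -/
theorem stmt_3 {V : Type*} [Fintype V] (t : ℕ) (ht : 2 ≤ t) (G : SimpleGraph V)
    (v : Fin t → V) (hv : Function.Injective v)
    (ep : Fin ((t - 1) ^ 2) → V)
    (P : ∀ i, G.Walk (v ⟨0, by omega⟩) (ep i))
    (hpath : ∀ i, (P i).IsPath)
    (hdisj : ∀ i j, i ≠ j → ∀ e ∈ (P i).edges, e ∉ (P j).edges)
    (hend : ∀ j : Fin t, j ≠ ⟨0, by omega⟩ → {i | ep i = v j}.ncard = t - 1) :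
    SimpleGraph.ImmersionVia (⊤ : SimpleGraph (Fin t)) G v := by
  have : Nonempty (Fin ((t - 1) ^ 2)) := ⟨⟨0, Nat.pow_pos (by omega)⟩⟩
  exact immersionVia_top_of_edgeDisjoint_walks hv ⟨0, by omega⟩ P hdisj hend
end

section
/- Let t ≥ 1 be an integer and let D be a finite simple Eulerian digraph in which every vertex has outdegree at least t(t-1). Then every nonempty set S ⊆ V(D) with |δ(S)| < 2t(t-1) satisfies |S| > t(t-1)/2; in particular, when t > 2 every such set S has |S| ≥ t. -/
/-- If every vertex has at least `m` out-neighbours in the loopless digraph `B`, then at least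
`|S| * (m + 1 - |S|)` edges leave `S`. -/
theorem ncard_mul_le_ncard_leaving {V : Type*} [Finite V] (B : V → V → Prop)
    (hB : ∀ v, ¬ B v v) (m : ℕ) (hm : ∀ x, m ≤ {u | B x u}.ncard) (S : Set V) :
    S.ncard * (m + 1 - S.ncard) ≤ {p : V × V | B p.1 p.2 ∧ p.1 ∈ S ∧ p.2 ∉ S}.ncard := by
  classical
  have := Fintype.ofFinite V
  have hfib : ∀ x ∈ S.toFinset, m + 1 - S.ncard ≤ {u | B x u ∧ u ∉ S}.toFinset.card := by
    intro x hx
    have hx : x ∈ S := by simpa using hx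
    have hsub : {u | B x u} ⊆ {u | B x u ∧ u ∉ S} ∪ (S \ {x}) := by
      intro u hu
      by_cases h : u ∈ S
      · exact Or.inr ⟨h, fun hux => hB x (hux ▸ hu)⟩
      · exact Or.inl ⟨hu, h⟩
    have h1 := Set.ncard_le_ncard hsub (Set.toFinite _)
    have h2 := Set.ncard_union_le {u | B x u ∧ u ∉ S} (S \ {x})
    have h3 := Set.ncard_sdiff_singleton_add_one hx (Set.toFinite S)
    have h4 := hm x
    rw [← Set.ncard_eq_toFinset_card']
    omega
  have hcard := Finset.card_nsmul_le_sum _ _ _ hfib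
  rw [← Finset.card_sigma, smul_eq_mul, ← Set.ncard_eq_toFinset_card'] at hcard
  refine hcard.trans ?_
  rw [Set.ncard_eq_toFinset_card']
  refine Finset.card_le_card_of_injOn (fun p => (p.1, p.2)) ?_ ?_
  · rintro ⟨x, u⟩ h
    simp at h ⊢
    tauto
  · rintro ⟨x, u⟩ _ ⟨y, v⟩ _ h
    simpa using h

/-- The number of edges entering `S` is the number of edges of the reversed digraph leaving `S`. -/
theorem ncard_entering_eq_ncard_flip_leaving {V : Type*} (A : V → V → Prop) (S : Set V) :
    {p : V × V | A p.1 p.2 ∧ p.2 ∈ S ∧ p.1 ∉ S}.ncard =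
      {p : V × V | flip A p.1 p.2 ∧ p.1 ∈ S ∧ p.2 ∉ S}.ncard := by
  rw [← Set.ncard_image_of_injective _ Prod.swap_injective]
  congr 1
  ext ⟨x, y⟩
  simp [flip]

/-- The edge-cut `δ(S)` consists of the edges leaving `S` and the edges entering `S`. -/
theorem ncard_diCutEdges {V : Type*} [Finite V] (A : V → V → Prop) (S : Set V) :
    (diCutEdges A S).ncard = {p : V × V | A p.1 p.2 ∧ p.1 ∈ S ∧ p.2 ∉ S}.ncard +
      {p : V × V | flip A p.1 p.2 ∧ p.1 ∈ S ∧ p.2 ∉ S}.ncard := by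
  rw [← ncard_entering_eq_ncard_flip_leaving, ← Set.ncard_union_eq ?_ (Set.toFinite _)
    (Set.toFinite _)]
  · congr 1
    ext p
    simp only [diCutEdges, Set.mem_ofPred_eq, Set.mem_union]
    tauto
  · rw [Set.disjoint_left]
    rintro p ⟨_, h, _⟩ ⟨_, _, h'⟩
    exact h' h

/-- In an Eulerian digraph with minimum outdegree at least `m`, a nonempty set whose edge-cut has
fewer than `2 * m` edges has more than `m` vertices. -/
theorem IsEulerianDigraph.lt_ncard_of_ncard_diCutEdges_lt {V : Type*} [Finite V]
    {A : V → V → Prop} (hEul : IsEulerianDigraph A) {m : ℕ} (hdeg : ∀ x, m ≤ diOutDeg A x)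
    {S : Set V} (hS : S.Nonempty) (hcut : (diCutEdges A S).ncard < 2 * m) : m < S.ncard := by
  by_contra! hle
  have h_out := ncard_mul_le_ncard_leaving A hEul.1 m hdeg S
  have h_in := ncard_mul_le_ncard_leaving (flip A) hEul.1 m
    (fun x => (hdeg x).trans (hEul.2 x).ge) S
  rw [ncard_diCutEdges] at hcut
  have hpos : 0 < S.ncard := (Set.ncard_pos (Set.toFinite S)).mpr hS
  obtain ⟨d, rfl⟩ := Nat.exists_eq_add_of_le hle
  have hd : S.ncard + d + 1 - S.ncard = d + 1 := by omega
  rw [hd] at h_out h_in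
  nlinarith

/-- In a finite simple Eulerian digraph with minimum outdegree at least
`t(t-1)`, every nonempty vertex set `S` with `|δ(S)| < 2t(t-1)` satisfies
`|S| > t(t-1)/2`; in particular, if `t > 2` then `|S| ≥ t`. -/
theorem stmt_7 {V : Type*} [Fintype V] (t : ℕ) (ht : 1 ≤ t)
    (A : V → V → Prop) (hEul : IsEulerianDigraph A)
    (hdeg : ∀ x : V, t * (t - 1) ≤ diOutDeg A x) :
    ∀ S : Set V, S.Nonempty → (diCutEdges A S).ncard < 2 * t * (t - 1) →
      ((t * (t - 1) : ℝ) / 2 < (S.ncard : ℝ) ∧ (2 < t → t ≤ S.ncard)) := by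
  intro S hS hcut
  have hlt : t * (t - 1) < S.ncard :=
    hEul.lt_ncard_of_ncard_diCutEdges_lt hdeg hS (by rwa [← mul_assoc])
  obtain ⟨k, rfl⟩ := Nat.exists_eq_add_of_le' ht
  rw [Nat.add_sub_cancel] at hlt
  refine ⟨?_, fun h => ?_⟩
  · have hcast : ((k : ℝ) + 1) * k < S.ncard := by exact_mod_cast hlt
    push_cast
    nlinarith [Nat.cast_nonneg (α := ℝ) k]
  · nlinarith
end

section
/- Let t ≥ 2 be an integer and let G be a finite simple graph. Suppose there exists a laminar family F of subsets of V(G) such that for every X ∈ F the edge-cut δ(X) has fewer than (t-1)^2 edges, and every block of the vertex partition induced by F has fewer than t vertices. Then G does not contain an immersion of the complete graph K_{t^2}. -/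
/-- A walk that leaves `X` traverses an edge of the cut `δ(X)`. -/
theorem SimpleGraph.Walk.exists_mem_edges_mem_cutEdges {V : Type*} {G : SimpleGraph V} {u v : V}
    (p : G.Walk u v) {X : Set V} (hu : u ∈ X) (hv : v ∉ X) :
    ∃ e ∈ p.edges, e ∈ G.cutEdges X := by
  obtain ⟨d, hd, h1, h2⟩ := p.exists_boundary_dart X hu hv
  exact ⟨d.edge, List.mem_map_of_mem hd, d.edge_mem, d.fst, d.snd, rfl, h1, h2⟩

/-- A cut separating two branch vertices of an immersion of `K_n` has at least `n - 1` edges. -/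
theorem SimpleGraph.ImmersionVia.card_sub_one_le_ncard_cutEdges {W V : Type*} [Fintype W]
    [Finite V] {G : SimpleGraph V} {φ : W → V} (h : (⊤ : SimpleGraph W).ImmersionVia G φ)
    {X : Set V} {a b : W} (ha : φ a ∈ X) (hb : φ b ∉ X) :
    Fintype.card W - 1 ≤ (G.cutEdges X).ncard := by
  classical
  obtain ⟨-, P, -, hdisj⟩ := h
  have hcross : ∀ c : {c : W // c ≠ b}, ∃ x y : W, φ x ∈ X ∧ φ y ∉ X ∧
      (φ c ∈ X ∧ x = c ∧ y = b ∨ φ c ∉ X ∧ x = a ∧ y = c) := by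
    intro c
    by_cases hc : φ c ∈ X
    · exact ⟨c, b, hc, hb, .inl ⟨hc, rfl, rfl⟩⟩
    · exact ⟨a, c, ha, hc, .inr ⟨hc, rfl, rfl⟩⟩
  choose x y hx hy hxy using hcross
  have hadj : ∀ c, (⊤ : SimpleGraph W).Adj (x c) (y c) := fun c hc => hy c (hc ▸ hx c)
  choose e he hcut using fun c => (P (hadj c)).exists_mem_edges_mem_cutEdges (hx c) (hy c)
  have hinj : Function.Injective e := by
    intro c d hcd
    by_contra hne
    refine hdisj (hadj c) (hadj d) ?_ (e c) (he c) (hcd ▸ he d)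
    intro hs
    have hval : (c : W) ≠ d := fun h => hne (Subtype.ext h)
    have hcb := c.2
    have hdb := d.2
    have hxc := hx c
    have hyd := hy d
    rcases Sym2.eq_iff.1 hs with ⟨h1, h2⟩ | ⟨h1, h2⟩
    · rcases hxy c with ⟨-, h3, h4⟩ | ⟨-, h3, h4⟩ <;>
        rcases hxy d with ⟨-, h5, h6⟩ | ⟨-, h5, h6⟩ <;> grind
    · exact hyd (h1 ▸ hxc)
  have hle := Nat.card_le_card_of_injective
    (fun c => (⟨e c, hcut c⟩ : G.cutEdges X)) fun c d h => hinj (congrArg Subtype.val h)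
  rw [Nat.card_eq_fintype_card, Fintype.card_subtype_compl, Fintype.card_subtype_eq,
    Nat.card_coe_set_eq] at hle
  exact hle

/-- If a finite simple graph admits a laminar family of edge-cuts of
size `< (t-1)^2` whose induced vertex partition has all blocks of size `< t`, then it
contains no immersion of `K_{t²}`. -/
theorem stmt_8 {V : Type*} [Fintype V] (t : ℕ) (ht : 2 ≤ t) (G : SimpleGraph V)
    (F : Set (Set V)) (hlam : IsLaminar F)
    (hcut : ∀ X ∈ F, (G.cutEdges X).ncard < (t - 1) ^ 2)
    (hblock : ∀ v : V, (laminarBlock F v).ncard < t) :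
    ¬ SimpleGraph.Immersion (⊤ : SimpleGraph (Fin (t ^ 2))) G := by
  rintro ⟨φ, h⟩
  have hpos : 0 < t ^ 2 := by positivity
  let b : Fin (t ^ 2) := ⟨0, hpos⟩
  have hsq : (t - 1) ^ 2 ≤ t ^ 2 - 1 := by
    obtain ⟨s, rfl⟩ : ∃ s, t = s + 1 := ⟨t - 1, by omega⟩
    simp only [Nat.add_sub_cancel]
    exact Nat.le_sub_of_add_le (by nlinarith)
  have hside : ∀ X ∈ F, ∀ c d, φ c ∈ X → φ d ∈ X := by
    intro X hX c d hc
    by_contra hd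
    have hle := h.card_sub_one_le_ncard_cutEdges hc hd
    rw [Fintype.card_fin] at hle
    exact absurd (hcut X hX) (by omega)
  have hsub : Set.range φ ⊆ laminarBlock F (φ b) := by
    rintro _ ⟨c, rfl⟩ X hX
    exact ⟨hside X hX c b, hside X hX b c⟩
  have hle := Set.ncard_le_ncard hsub (Set.toFinite _)
  rw [← Set.image_univ, Set.ncard_image_of_injective _ h.1, Set.ncard_univ, Nat.card_eq_fintype_card,
    Fintype.card_fin] at hle
  have := hblock (φ b)
  nlinarith
end

section
/- Let t ≥ 2 be an integer and let D be a finite simple Eulerian digraph. Suppose there exists a laminar family F of subsets of V(D) such that for every X ∈ F the edge-cut δ(X) has fewer than 2t(t-1) edges, and every block of the vertex partition induced by F has fewer than t vertices. Then D does not contain an immersion of the bidirected complete digraph K⃗_{t^2}. -/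
/-- A directed walk whose ends are separated by `X` traverses an edge of the cut `δ(X)`. -/
theorem exists_mem_diWalkEdges_mem_diCutEdges {V : Type*} {A : V → V → Prop} {X : Set V} {y : V} :
    ∀ {l : List V} {x : V}, l.IsChain A → l.head? = some x → l.getLast? = some y →
      ¬ (x ∈ X ↔ y ∈ X) → ∃ e ∈ diWalkEdges l, e ∈ diCutEdges A X
  | [], _, _, hx, _, _ => by simp at hx
  | [a], x, _, hx, hy, hxy => by
    simp only [List.head?_cons, Option.some.injEq, List.getLast?_singleton] at hx hy
    subst hx hy
    exact absurd Iff.rfl hxy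
  | a :: b :: l, x, hl, hx, hy, hxy => by
    simp only [List.head?_cons, Option.some.injEq] at hx
    subst hx
    rw [List.isChain_cons_cons] at hl
    by_cases hab : a ∈ X ↔ b ∈ X
    · obtain ⟨e, he, hcut⟩ := exists_mem_diWalkEdges_mem_diCutEdges (x := b) hl.2 rfl
        (by simpa using hy) (by rwa [← hab])
      exact ⟨e, List.mem_cons_of_mem _ he, hcut⟩
    · exact ⟨(a, b), List.mem_cons_self, hl.1, hab⟩

/-- If `X` contains exactly `k` of the `n` branch vertices of an immersed bidirected complete
digraph, then the cut `δ(X)` has at least `2k(n-k)` edges. -/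
theorem two_mul_card_mul_card_le_ncard_diCutEdges {V : Type*} [Finite V] {n : ℕ}
    {A : V → V → Prop} {φ : Fin n → V} (hφ : DiImmersionVia (bidirComplete n) A φ)
    {X : Set V} {s : Finset (Fin n)} (hs : ∀ a, a ∈ s ↔ φ a ∈ X) :
    2 * (s.card * sᶜ.card) ≤ (diCutEdges A X).ncard := by
  classical
  obtain ⟨-, P, hpath, hdisj⟩ := hφ
  have hss : Disjoint (s ×ˢ sᶜ) (sᶜ ×ˢ s) := by
    rw [Finset.disjoint_left]
    simp +contextual
  have hsep : ∀ p ∈ (s ×ˢ sᶜ).disjUnion (sᶜ ×ˢ s) hss, ¬ (φ p.1 ∈ X ↔ φ p.2 ∈ X) := by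
    simp only [Finset.mem_disjUnion, Finset.mem_product, Finset.mem_compl, ← hs]
    tauto
  have hne : ∀ p : Fin n × Fin n, ¬ (φ p.1 ∈ X ↔ φ p.2 ∈ X) → bidirComplete n p.1 p.2 :=
    fun p hp h => hp (by rw [h])
  have hex : ∀ p : Fin n × Fin n, ∀ hp : ¬ (φ p.1 ∈ X ↔ φ p.2 ∈ X),
      ∃ e ∈ diWalkEdges (P (hne p hp)), e ∈ diCutEdges A X := fun p hp =>
    have h := hpath (hne p hp)
    exists_mem_diWalkEdges_mem_diCutEdges h.1 h.2.1 h.2.2.1 hp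
  choose f hf hfX using hex
  have hfin : (diCutEdges A X).Finite := Set.toFinite _
  calc 2 * (s.card * sᶜ.card) = ((s ×ˢ sᶜ).disjUnion (sᶜ ×ˢ s) hss).card := by
        rw [Finset.card_disjUnion, Finset.card_product, Finset.card_product]; ring
    _ ≤ hfin.toFinset.card := by
        refine Finset.card_le_card_of_injOn
          (fun p => if hp : ¬ (φ p.1 ∈ X ↔ φ p.2 ∈ X) then f p hp else (φ p.1, φ p.2))
          (fun p hp => ?_) (fun p hp q hq hpq => ?_)
        · simpa [hsep p hp] using hfX p (hsep p hp)
        · have hp := hsep p hp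
          have hq := hsep q hq
          simp only [dif_pos hp, dif_pos hq] at hpq
          by_contra hne'
          exact hdisj (hne p hp) (hne q hq) hne' _ (hf p hp) (hpq ▸ hf q hq)
    _ = (diCutEdges A X).ncard := (Set.ncard_eq_toFinset_card _ hfin).symm

/-- If a finite simple Eulerian digraph admits a laminar family of
edge-cuts of size `< 2t(t-1)` whose induced vertex partition has all blocks of size
`< t`, then it contains no immersion of the bidirected complete digraph `K⃗_{t²}`. -/
theorem stmt_9 {V : Type*} [Fintype V] (t : ℕ) (ht : 2 ≤ t) (A : V → V → Prop)
    (hEul : IsEulerianDigraph A)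
    (F : Set (Set V)) (hlam : IsLaminar F)
    (hcut : ∀ X ∈ F, (diCutEdges A X).ncard < 2 * t * (t - 1))
    (hblock : ∀ v : V, (laminarBlock F v).ncard < t) :
    ¬ DiImmersion (bidirComplete (t ^ 2)) A := by
  rintro ⟨φ, hφ⟩
  have hsame : ∀ X ∈ F, ∀ a b, φ a ∈ X → φ b ∈ X := by
    intro X hX a b ha
    by_contra hb
    classical
    have hle := two_mul_card_mul_card_le_ncard_diCutEdges hφ (X := X)
      (s := Finset.univ.filter fun c => φ c ∈ X) (by simp)
    have hlt := hcut X hX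
    set s := Finset.univ.filter fun c => φ c ∈ X
    have hs : 0 < s.card := Finset.card_pos.2 ⟨a, by simpa [s] using ha⟩
    have hsc : 0 < sᶜ.card := Finset.card_pos.2 ⟨b, by simpa [s] using hb⟩
    have hsum : s.card + sᶜ.card = t ^ 2 := by
      rw [Finset.card_add_card_compl, Fintype.card_fin]
    obtain ⟨r, rfl⟩ := Nat.exists_eq_add_of_le' (by lia : 1 ≤ t)
    simp only [Nat.add_sub_cancel] at hlt
    nlinarith
  have hpos : 0 < t ^ 2 := by positivity
  have hsub : Set.range φ ⊆ laminarBlock F (φ ⟨0, hpos⟩) := by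
    rintro _ ⟨a, rfl⟩ X hX
    exact ⟨hsame X hX _ _, hsame X hX _ _⟩
  have hcard := Set.ncard_le_ncard hsub (Set.toFinite _)
  rw [Set.ncard_range_of_injective hφ.1, Nat.card_fin] at hcard
  nlinarith [hblock (φ ⟨0, hpos⟩)]
end
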